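/- (Onion exclusion) Suppose every off-backbone forest path started at any south vertex v stays in the translated parabolic region v + P_S^{log^2 n}, and symmetrically for north vertices with the upward parabola. Let r_2 >= 1 and l >= 1, and suppose there exists an 'onion': a backbone path with two disjoint segments pi_1, pi_2 crossing a box of width 2 r_1 and height 2 r_2 in opposite horizontal directions, entering and exiting on opposite vertical sides in the pattern described, such that at most l backbone paths enter the region M bounded between pi_1 and pi_2. Then r_1 < 10 l sqrt(r_2) log^2 n. -/

import Mathlib

/-!
STATEMENT 14 (Onion exclusion): In the two-periodic Aztec diamond of size `n`, suppose
every off-backbone south forest path started at a south vertex `v` stays in the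
translated downward parabolic region `v + P_S^{log²n}`, and symmetrically for north
vertices with the upward parabola.  If there is an "onion": a backbone path with two
disjoint segments `π₁, π₂` crossing a box of width `2r₁` and height `2r₂` in opposite
horizontal directions, entering and exiting on opposite vertical sides in the described
pattern, such that at most `l` backbone paths enter the region `M` bounded between `π₁`
and `π₂`, then `r₁ < 10·l·√r₂·log²n`.
-/

open scoped Classical

noncomputable section

def diagDirs : Set (ℤ × ℤ) := {(1, 1), (1, -1), (-1, 1), (-1, -1)}
def WhiteV (v : ℤ × ℤ) : Prop := Odd v.1 ∧ Even v.2
def BlackV (v : ℤ × ℤ) : Prop := Even v.1 ∧ Odd v.2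
def inBox (n : ℤ) (v : ℤ × ℤ) : Prop := |v.1| ≤ n ∧ |v.2| ≤ n

def IsAztecMatching (n : ℤ) (M : Set ((ℤ × ℤ) × (ℤ × ℤ))) : Prop :=
  (∀ p ∈ M, WhiteV p.1 ∧ (p.2 - p.1) ∈ diagDirs ∧ inBox n p.1 ∧ inBox n p.2) ∧
  (∀ v, WhiteV v → inBox n v → ∃! b, (v, b) ∈ M) ∧
  (∀ b, BlackV b → inBox n b → ∃! v, (v, b) ∈ M)

/-- South-class vertices. -/
def Stilde (v : ℤ × ℤ) : Prop := Odd v.1 ∧ Even v.2 ∧ (4 : ℤ) ∣ (v.1 + v.2 - 1)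

/-- North-class vertices. -/
def Ntilde (v : ℤ × ℤ) : Prop := Odd v.1 ∧ Even v.2 ∧ (4 : ℤ) ∣ (v.1 + v.2 + 1)

/-- One step of the south Temperleyan forest (for `v` a south vertex inside the box). -/
def SStepRel (M : Set ((ℤ × ℤ) × (ℤ × ℤ))) (n : ℤ) (v w : ℤ × ℤ) : Prop :=
  Stilde v ∧ |v.1| ≤ n ∧ ∃ e ∈ diagDirs, (v, v + e) ∈ M ∧ w = v + e + e

/-- One step of the north Temperleyan forest. -/
def NStepRel (M : Set ((ℤ × ℤ) × (ℤ × ℤ))) (n : ℤ) (v w : ℤ × ℤ) : Prop :=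
  Ntilde v ∧ |v.1| ≤ n ∧ ∃ e ∈ diagDirs, (v, v + e) ∈ M ∧ w = v + e + e

/-- Source vertices of the south forest (on the north/south boundary rows). -/
def SSource (n : ℤ) (v : ℤ × ℤ) : Prop := Stilde v ∧ |v.1| ≤ n ∧ |v.2| = n

/-- Source vertices of the north forest. -/
def NSource (n : ℤ) (v : ℤ × ℤ) : Prop := Ntilde v ∧ |v.1| ≤ n ∧ |v.2| = n

/-- The backbone of the south forest: all vertices on forest paths from sources. -/
def SBackbone (M : Set ((ℤ × ℤ) × (ℤ × ℤ))) (n : ℤ) : Set (ℤ × ℤ) :=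
  {w | ∃ v, SSource n v ∧ Relation.ReflTransGen (SStepRel M n) v w}

/-- The backbone of the north forest. -/
def NBackbone (M : Set ((ℤ × ℤ) × (ℤ × ℤ))) (n : ℤ) : Set (ℤ × ℤ) :=
  {w | ∃ v, NSource n v ∧ Relation.ReflTransGen (NStepRel M n) v w}

/-- The downward parabolic region `P_S^α`. -/
def PparS (α : ℝ) : Set (ℤ × ℤ) :=
  {p | (p.2 : ℝ) ≤ α ∧
    |(p.1 : ℝ)| ≤ (α + Real.log (max (-(p.2 : ℝ)) 0 + 1)) * Real.sqrt (max (-(p.2 : ℝ)) 0 + 1)}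

/-- The upward parabolic region `P_N^α` (the rotation of `P_S^α` by `π`). -/
def PparN (α : ℝ) : Set (ℤ × ℤ) := {p | (-p.1, -p.2) ∈ PparS α}

/-- The event `Para_S(α)`: every south forest path, run until it hits the south
backbone, stays in the parabola `v + P_S^α` around its starting point. -/
def ParaSHolds (M : Set ((ℤ × ℤ) × (ℤ × ℤ))) (n : ℤ) (α : ℝ) : Prop :=
  ∀ v w, Stilde v → inBox n v →
    Relation.ReflTransGen (fun x y => SStepRel M n x y ∧ x ∉ SBackbone M n) v w →
    (w - v) ∈ PparS α

/-- The event `Para_N(α)`. -/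
def ParaNHolds (M : Set ((ℤ × ℤ) × (ℤ × ℤ))) (n : ℤ) (α : ℝ) : Prop :=
  ∀ v w, Ntilde v → inBox n v →
    Relation.ReflTransGen (fun x y => NStepRel M n x y ∧ x ∉ NBackbone M n) v w →
    (w - v) ∈ PparN α

/-- A (south) backbone path from the source `u`, absorbed when it leaves the box. -/
def IsSPath (M : Set ((ℤ × ℤ) × (ℤ × ℤ))) (n : ℤ) (u : ℤ × ℤ) (p : ℕ → ℤ × ℤ) : Prop :=
  p 0 = u ∧ ∀ i, SStepRel M n (p i) (p (i + 1)) ∨ (¬|(p i).1| ≤ n ∧ p (i + 1) = p i)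

/-- A (north) backbone path from the source `u`. -/
def IsNPath (M : Set ((ℤ × ℤ) × (ℤ × ℤ))) (n : ℤ) (u : ℤ × ℤ) (p : ℕ → ℤ × ℤ) : Prop :=
  p 0 = u ∧ ∀ i, NStepRel M n (p i) (p (i + 1)) ∨ (¬|(p i).1| ≤ n ∧ p (i + 1) = p i)

/-- The piecewise linear interpolation of a lattice path, as a plane curve. -/
def interp (p : ℕ → ℤ × ℤ) (t : ℝ) : ℝ × ℝ :=
  ((1 - (t - ⌊t⌋₊)) * ((p ⌊t⌋₊).1 : ℝ) + (t - ⌊t⌋₊) * ((p (⌊t⌋₊ + 1)).1 : ℝ),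
   (1 - (t - ⌊t⌋₊)) * ((p ⌊t⌋₊).2 : ℝ) + (t - ⌊t⌋₊) * ((p (⌊t⌋₊ + 1)).2 : ℝ))

/-- The closed box of half-width `r₁` and half-height `r₂` centered at `v`. -/
def boxR (v : ℝ × ℝ) (r1 r2 : ℝ) : Set (ℝ × ℝ) :=
  {x | |x.1 - v.1| ≤ r1 ∧ |x.2 - v.2| ≤ r2}

/-- A vertical edge (`σ = 1`: right edge, `σ = -1`: left edge) of the box. -/
def vertEdge (v : ℝ × ℝ) (r1 r2 : ℝ) (σ : ℝ) : Set (ℝ × ℝ) :=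
  {x ∈ boxR v r1 r2 | x.1 = v.1 + σ * r1}

/-- The top and bottom (horizontal) edges of the box. -/
def horEdges (v : ℝ × ℝ) (r1 r2 : ℝ) : Set (ℝ × ℝ) :=
  {x ∈ boxR v r1 r2 | |x.2 - v.2| = r2}

/-- The union of the two path segments and the region of the box bounded between them:
the points of the box that cannot be joined to the top or bottom edges without
touching the segments. -/
def betweenRegion (B π12 topbot : Set (ℝ × ℝ)) : Set (ℝ × ℝ) :=
  π12 ∪ {x ∈ B | ∀ y ∈ topbot, ¬JoinedIn (B \ π12) x y}

/-- The sublattice of south (`τ = 1`) or north (`τ = -1`) vertices. -/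
def Typ (τ : ℤ) (v : ℤ × ℤ) : Prop := Odd v.1 ∧ Even v.2 ∧ (4 : ℤ) ∣ (v.1 + v.2 - τ)

/-- Diagonal neighbours in a sublattice. -/
def Diag (a b : ℤ × ℤ) : Prop :=
  (b.1 = a.1 + 2 ∨ b.1 = a.1 - 2) ∧ (b.2 = a.2 + 2 ∨ b.2 = a.2 - 2)

/-- Forest step, for both sublattices at once. -/
def Stp (M : Set ((ℤ × ℤ) × (ℤ × ℤ))) (n τ : ℤ) (v w : ℤ × ℤ) : Prop :=
  Typ τ v ∧ |v.1| ≤ n ∧ ∃ e ∈ diagDirs, (v, v + e) ∈ M ∧ w = v + e + e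

/-- The edge `ab` crosses the upward vertical ray started just to the right of `w`. -/
def crossR (a b w : ℤ × ℤ) : ZMod 2 :=
  if a.1 + b.1 = 2 * w.1 + 2 ∧ 2 * w.2 < a.2 + b.2 then 1 else 0

/-- The edge `ab` crosses the upward vertical ray started just to the left of `w`. -/
def crossL (a b w : ℤ × ℤ) : ZMod 2 :=
  if a.1 + b.1 = 2 * w.1 - 2 ∧ 2 * w.2 < a.2 + b.2 then 1 else 0

/-- The vertex `z` is vertically above `w`. -/
def above (z w : ℤ × ℤ) : ZMod 2 := if z.1 = w.1 ∧ w.2 < z.2 then 1 else 0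

/-- The edges `ab` and `ww'` have the same midpoint. -/
def hits (a b w w' : ℤ × ℤ) : ZMod 2 :=
  if a.1 + b.1 = w.1 + w'.1 ∧ a.2 + b.2 = w.2 + w'.2 then 1 else 0

lemma zmod2_self (x : ZMod 2) : x + x = 0 := CharTwo.add_self_eq_zero x

lemma zmod2_eq {x y : ZMod 2} (h : x + y = 0) : x = y := by
  revert x y; decide

lemma crossR_add_crossL {τ : ℤ} (hτ : τ = 1 ∨ τ = -1) {a b w : ℤ × ℤ} (ha : Typ τ a)
    (hb : Typ τ b) (hw : Typ (-τ) w) (hab : Diag a b) :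
    crossR a b w + crossL a b w = above a w + above b w := by
  obtain ⟨⟨k1, h1⟩, ⟨k2, h2⟩, h3⟩ := ha
  obtain ⟨⟨k4, h4⟩, ⟨k5, h5⟩, h6⟩ := hb
  obtain ⟨⟨k7, h7⟩, ⟨k8, h8⟩, h9⟩ := hw
  obtain ⟨h10, h11⟩ := hab
  unfold crossR crossL above
  rcases hτ with rfl | rfl <;> rcases h10 with h10 | h10 <;> rcases h11 with h11 | h11 <;>
    split_ifs <;> first | rfl | (exfalso; omega)

lemma crossR_add_crossL' {τ : ℤ} (hτ : τ = 1 ∨ τ = -1) {a b w w' : ℤ × ℤ} (ha : Typ τ a)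
    (hb : Typ τ b) (hab : Diag a b) (hw : Typ (-τ) w)
    (h1 : w'.1 = w.1 + 2) (h2 : w'.2 = w.2 + 2 ∨ w'.2 = w.2 - 2) :
    crossR a b w + crossL a b w' = hits a b w w' := by
  obtain ⟨⟨k1, h1⟩, ⟨k2, h2⟩, h3⟩ := ha
  obtain ⟨⟨k4, h4⟩, ⟨k5, h5⟩, h6⟩ := hb
  obtain ⟨⟨k7, h7⟩, ⟨k8, h8⟩, h9⟩ := hw
  obtain ⟨h10, h11⟩ := hab
  unfold crossR crossL hits
  rcases hτ with rfl | rfl <;> rcases h10 with h10 | h10 <;> rcases h11 with h11 | h11 <;>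
    split_ifs <;> first | rfl | (exfalso; omega)

/-- A lattice path in the sublattice `τ` over the index range `[i0, i1)`. -/
def LPath (τ : ℤ) (p : ℕ → ℤ × ℤ) (i0 i1 : ℕ) : Prop :=
  ∀ i, i0 ≤ i → i < i1 → Typ τ (p i) ∧ Typ τ (p (i + 1)) ∧ Diag (p i) (p (i + 1))

def FR (p : ℕ → ℤ × ℤ) (i0 i1 : ℕ) (w : ℤ × ℤ) : ZMod 2 :=
  ∑ i ∈ Finset.Ico i0 i1, crossR (p i) (p (i + 1)) w

def FL (p : ℕ → ℤ × ℤ) (i0 i1 : ℕ) (w : ℤ × ℤ) : ZMod 2 :=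
  ∑ i ∈ Finset.Ico i0 i1, crossL (p i) (p (i + 1)) w

def FH (p : ℕ → ℤ × ℤ) (i0 i1 : ℕ) (w w' : ℤ × ℤ) : ZMod 2 :=
  ∑ i ∈ Finset.Ico i0 i1, hits (p i) (p (i + 1)) w w'

lemma sum_telescope_zmod2 (f : ℕ → ZMod 2) {i0 i1 : ℕ} (h : i0 ≤ i1) :
    ∑ i ∈ Finset.Ico i0 i1, (f i + f (i + 1)) = f i0 + f i1 := by
  induction i1, h using Nat.le_induction with
  | base => simp [zmod2_self]
  | succ k hk ih =>
    rw [Finset.sum_Ico_succ_top hk, ih]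
    linear_combination zmod2_self (f k)

lemma FR_add_FL {τ : ℤ} (hτ : τ = 1 ∨ τ = -1) {p : ℕ → ℤ × ℤ} {i0 i1 : ℕ} (h01 : i0 ≤ i1)
    (hp : LPath τ p i0 i1) {w : ℤ × ℤ} (hw : Typ (-τ) w) :
    FR p i0 i1 w + FL p i0 i1 w = above (p i0) w + above (p i1) w := by
  rw [← sum_telescope_zmod2 (fun i => above (p i) w) h01, FR, FL, ← Finset.sum_add_distrib]
  refine Finset.sum_congr rfl fun i hi => ?_
  rw [Finset.mem_Ico] at hi
  obtain ⟨h1, h2, h3⟩ := hp i hi.1 hi.2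
  exact crossR_add_crossL hτ h1 h2 hw h3

lemma FR_add_FL' {τ : ℤ} (hτ : τ = 1 ∨ τ = -1) {p : ℕ → ℤ × ℤ} {i0 i1 : ℕ}
    (hp : LPath τ p i0 i1) {w w' : ℤ × ℤ} (hw : Typ (-τ) w)
    (h1 : w'.1 = w.1 + 2) (h2 : w'.2 = w.2 + 2 ∨ w'.2 = w.2 - 2) :
    FR p i0 i1 w + FL p i0 i1 w' = FH p i0 i1 w w' := by
  rw [FR, FL, FH, ← Finset.sum_add_distrib]
  refine Finset.sum_congr rfl fun i hi => ?_
  rw [Finset.mem_Ico] at hi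
  obtain ⟨h1', h2', h3⟩ := hp i hi.1 hi.2
  exact crossR_add_crossL' hτ h1' h2' h3 hw h1 h2

lemma FR_adj {τ : ℤ} (hτ : τ = 1 ∨ τ = -1) {p : ℕ → ℤ × ℤ} {i0 i1 : ℕ} (h01 : i0 ≤ i1)
    (hp : LPath τ p i0 i1) {w w' : ℤ × ℤ} (hw : Typ (-τ) w) (hw' : Typ (-τ) w')
    (h1 : w'.1 = w.1 + 2) (h2 : w'.2 = w.2 + 2 ∨ w'.2 = w.2 - 2) :
    FR p i0 i1 w + FR p i0 i1 w' = FH p i0 i1 w w' + above (p i0) w' + above (p i1) w' := by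
  have e1 := FR_add_FL hτ h01 hp hw'
  have e2 := FR_add_FL' hτ hp hw h1 h2
  linear_combination e1 + e2 - zmod2_self (FL p i0 i1 w')

lemma mem_diagDirs {e : ℤ × ℤ} :
    e ∈ diagDirs ↔ (e.1 = 1 ∨ e.1 = -1) ∧ (e.2 = 1 ∨ e.2 = -1) := by
  obtain ⟨a, b⟩ := e
  simp only [diagDirs, Set.mem_insert_iff, Set.mem_singleton_iff, Prod.mk.injEq]
  tauto

section Matching

variable {n : ℤ} {M : Set ((ℤ × ℤ) × (ℤ × ℤ))}

/-- A forest step in coordinates. -/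
lemma Stp.unpack {τ : ℤ} {v w : ℤ × ℤ} (h : Stp M n τ v w) :
    ∃ m : ℤ × ℤ, (v, m) ∈ M ∧ v.1 + w.1 = 2 * m.1 ∧ v.2 + w.2 = 2 * m.2 ∧
      (m.1 = v.1 + 1 ∨ m.1 = v.1 - 1) ∧ (m.2 = v.2 + 1 ∨ m.2 = v.2 - 1) := by
  obtain ⟨-, -, e, he, hm, rfl⟩ := h
  rw [mem_diagDirs] at he
  refine ⟨v + e, hm, ?_, ?_, ?_, ?_⟩ <;> simp only [Prod.fst_add, Prod.snd_add] <;> omega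

lemma Stp.diag {τ : ℤ} {v w : ℤ × ℤ} (h : Stp M n τ v w) : Diag v w := by
  obtain ⟨m, -, h1, h2, h3, h4⟩ := h.unpack
  unfold Diag; omega

lemma Typ.of_diag {τ : ℤ} {v w : ℤ × ℤ} (h : Typ τ v) (hd : Diag v w) : Typ τ w := by
  obtain ⟨⟨k1, h1⟩, ⟨k2, h2⟩, h3⟩ := h
  obtain ⟨h4, h5⟩ := hd
  refine ⟨?_, ?_, ?_⟩
  · rw [Int.odd_iff]; omega
  · rw [Int.even_iff]; omega
  · omega

lemma Stp.typ_right {τ : ℤ} {v w : ℤ × ℤ} (h : Stp M n τ v w) : Typ τ w :=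
  h.1.of_diag h.diag

lemma Typ.disjoint {τ : ℤ} (hτ : τ = 1 ∨ τ = -1) {v : ℤ × ℤ} (h : Typ τ v) : ¬ Typ (-τ) v := by
  rintro ⟨-, -, h'⟩
  have := h.2.2
  rcases hτ with rfl | rfl <;> omega

lemma Stp.inBox_left (hM : IsAztecMatching n M) {τ : ℤ} {v w : ℤ × ℤ} (h : Stp M n τ v w) :
    inBox n v := by
  obtain ⟨m, hm, -⟩ := h.unpack
  exact (hM.1 _ hm).2.2.1

lemma Stp.bounds (hM : IsAztecMatching n M) (hn : (4 : ℤ) ∣ n) {τ : ℤ} {v w : ℤ × ℤ}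
    (h : Stp M n τ v w) : |w.1| ≤ n + 1 ∧ |w.2| ≤ n := by
  obtain ⟨m, hm, h1, h2, h3, h4⟩ := h.unpack
  obtain ⟨-, -, ⟨h5, h6⟩, h7, h8⟩ := hM.1 _ hm
  obtain ⟨⟨k1, ho⟩, ⟨k2, he⟩, -⟩ := h.1
  simp only [abs_le] at *
  omega

lemma Stp.functional (hM : IsAztecMatching n M) {τ : ℤ} {v w w' : ℤ × ℤ}
    (h : Stp M n τ v w) (h' : Stp M n τ v w') : w = w' := by
  obtain ⟨m, hm, h1, h2, h3, h4⟩ := h.unpack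
  obtain ⟨m', hm', h1', h2', h3', h4'⟩ := h'.unpack
  obtain ⟨hW, -, hB, -⟩ := hM.1 _ hm
  have := (hM.2.1 v hW hB).unique hm hm'
  subst this
  ext <;> omega

/-- Two matched edges with the same midpoint have the same white vertex. -/
lemma Stp.midpoint_inj (hM : IsAztecMatching n M) {τ τ' : ℤ} {v w v' w' : ℤ × ℤ}
    (h : Stp M n τ v w) (h' : Stp M n τ' v' w')
    (e1 : v.1 + w.1 = v'.1 + w'.1) (e2 : v.2 + w.2 = v'.2 + w'.2) : v = v' := by
  obtain ⟨m, hm, h1, h2, h3, h4⟩ := h.unpack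
  obtain ⟨m', hm', h1', h2', h3', h4'⟩ := h'.unpack
  have hmm : m = m' := by ext <;> omega
  subst hmm
  obtain ⟨⟨⟨k1, hW1⟩, ⟨k2, hW2⟩⟩, -, -, hB⟩ := hM.1 _ hm
  refine (hM.2.2 m ⟨?_, ?_⟩ hB).unique hm hm'
  · rw [Int.even_iff]; simp only at hW1; omega
  · rw [Int.odd_iff]; simp only at hW2; omega

lemma exists_stp (hM : IsAztecMatching n M) {τ : ℤ} {v : ℤ × ℤ} (hv : Typ τ v)
    (hB : inBox n v) : ∃ w, Stp M n τ v w := by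
  obtain ⟨b, hb, -⟩ := hM.2.1 v ⟨hv.1, hv.2.1⟩ hB
  refine ⟨v + (b - v) + (b - v), hv, hB.1, b - v, (hM.1 _ hb).2.1, ?_, rfl⟩
  simpa using hb

lemma FH_eq_zero_of_dual (hM : IsAztecMatching n M) {τ : ℤ} (hτ : τ = 1 ∨ τ = -1)
    {p : ℕ → ℤ × ℤ} {i0 i1 : ℕ} (hp : ∀ i, i0 ≤ i → i < i1 → Stp M n τ (p i) (p (i + 1)))
    {w w' : ℤ × ℤ} (h : Stp M n (-τ) w w') : FH p i0 i1 w w' = 0 := by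
  refine Finset.sum_eq_zero fun i hi => ?_
  rw [Finset.mem_Ico] at hi
  have hs := hp i hi.1 hi.2
  refine if_neg fun hh => ?_
  have := hs.midpoint_inj hM h hh.1 hh.2
  exact (hs.1.disjoint hτ) (this ▸ h.1)

lemma FH_eq_one (hM : IsAztecMatching n M) {τ : ℤ}
    {p : ℕ → ℤ × ℤ} {i0 i1 : ℕ} (hp : ∀ i, i0 ≤ i → i < i1 → Stp M n τ (p i) (p (i + 1)))
    (hinj : ∀ i j, i0 ≤ i → i < i1 → i0 ≤ j → j < i1 → p i = p j → i = j)
    {w w' : ℤ × ℤ} {i : ℕ} (hi : i0 ≤ i) (hi' : i < i1)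
    (e1 : (p i).1 + (p (i + 1)).1 = w.1 + w'.1) (e2 : (p i).2 + (p (i + 1)).2 = w.2 + w'.2) :
    FH p i0 i1 w w' = 1 := by
  rw [FH, Finset.sum_eq_single_of_mem i (Finset.mem_Ico.2 ⟨hi, hi'⟩)]
  · exact if_pos ⟨e1, e2⟩
  · intro j hj hji
    rw [Finset.mem_Ico] at hj
    refine if_neg fun hh => hji ?_
    refine hinj j i hj.1 hj.2 hi hi' ?_
    exact (hp j hj.1 hj.2).midpoint_inj hM (hp i hi hi') (by omega) (by omega)

lemma hits_comm (a b w w' : ℤ × ℤ) : hits a b w w' = hits a b w' w := by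
  unfold hits; rw [add_comm w.1, add_comm w.2]

lemma FH_comm (p : ℕ → ℤ × ℤ) (i0 i1 : ℕ) (w w' : ℤ × ℤ) :
    FH p i0 i1 w w' = FH p i0 i1 w' w := by
  unfold FH; exact Finset.sum_congr rfl fun i _ => hits_comm _ _ _ _

/-- For a closed path the crossing parity changes exactly across edges of the path. -/
lemma FR_adj_closed {τ : ℤ} (hτ : τ = 1 ∨ τ = -1) {p : ℕ → ℤ × ℤ} {i0 i1 : ℕ} (h01 : i0 ≤ i1)
    (hp : LPath τ p i0 i1) (hc : p i0 = p i1) {w w' : ℤ × ℤ} (hw : Typ (-τ) w)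
    (hw' : Typ (-τ) w') (hd : Diag w w') :
    FR p i0 i1 w + FR p i0 i1 w' = FH p i0 i1 w w' := by
  obtain ⟨h1 | h1, h2⟩ := hd
  · rw [FR_adj hτ h01 hp hw hw' h1 h2, hc, add_assoc, zmod2_self, add_zero]
  · rw [add_comm, FH_comm, FR_adj hτ h01 hp hw' hw (by omega) (by omega), hc, add_assoc,
      zmod2_self, add_zero]

/-- The upper and the lower dual vertex across an edge. -/
lemma exists_dual_pair {τ : ℤ} (hτ : τ = 1 ∨ τ = -1) {p q : ℤ × ℤ} (h1 : Typ τ p)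
    (hdg : Diag p q) : ∃ wu wd : ℤ × ℤ, Typ (-τ) wu ∧ Typ (-τ) wd ∧ Diag wd wu ∧
      p.1 + q.1 = wd.1 + wu.1 ∧ p.2 + q.2 = wd.2 + wu.2 ∧ wu.2 = wd.2 + 2 ∧
      (wd.1 = p.1 ∨ wd.1 = q.1) ∧ (wd.2 = p.2 ∨ wd.2 = q.2) := by
  obtain ⟨⟨k1, h1a⟩, ⟨k2, h1b⟩, h1c⟩ := h1
  obtain ⟨h3, h4⟩ := hdg
  rcases h4 with h4 | h4
  · refine ⟨(p.1, q.2), (q.1, p.2), ⟨?_, ?_, ?_⟩, ⟨?_, ?_, ?_⟩, ⟨?_, ?_⟩, ?_, ?_, ?_, Or.inr rfl,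
      Or.inl rfl⟩ <;>
      simp only [Int.odd_iff, Int.even_iff] <;> rcases hτ with rfl | rfl <;> omega
  · refine ⟨(q.1, p.2), (p.1, q.2), ⟨?_, ?_, ?_⟩, ⟨?_, ?_, ?_⟩, ⟨?_, ?_⟩, ?_, ?_, ?_, Or.inl rfl,
      Or.inr rfl⟩ <;>
      simp only [Int.odd_iff, Int.even_iff] <;> rcases hτ with rfl | rfl <;> omega

/-- The forests have no infinite paths. -/
lemma no_infinite_walk (hM : IsAztecMatching n M) (hn : (4 : ℤ) ∣ n) (k : ℕ) :
    ∀ τ : ℤ, (τ = 1 ∨ τ = -1) → ∀ b : ℕ → ℤ × ℤ, (∀ i, Stp M n τ (b i) (b (i + 1))) →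
      (∀ i, (b i).2 ≤ -n + k) → False := by
  induction k using Nat.strong_induction_on with
  | _ k ih =>
  intro τ hτ b hb hk
  have hbox : ∀ i, b i ∈ Set.Icc ((-n, -n) : ℤ × ℤ) (n, n) := by
    intro i
    obtain ⟨h1, h2⟩ := (hb i).inBox_left hM
    rw [abs_le] at h1 h2
    exact ⟨⟨h1.1, h2.1⟩, ⟨h1.2, h2.2⟩⟩
  have hex : ∃ j, ∃ i < j, b i = b j := by
    obtain ⟨i, j, hij, he⟩ := Set.Finite.exists_lt_map_eq_of_forall_mem hbox
      (Set.finite_Icc _ _)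
    exact ⟨j, i, hij, he⟩
  obtain ⟨i0, hi01, hc⟩ := Nat.find_spec hex
  have hmin := fun m hm => Nat.find_min hex (m := m) hm
  generalize Nat.find hex = i1 at *
  have hinj : ∀ i j, i0 ≤ i → i < i1 → i0 ≤ j → j < i1 → b i = b j → i = j := by
    intro i j _ hi _ hj h
    rcases lt_trichotomy i j with hlt | he | hlt
    · exact absurd ⟨i, hlt, h⟩ (hmin j hj)
    · exact he
    · exact absurd ⟨j, hlt, h.symm⟩ (hmin i hi)
  have hp : LPath τ b i0 i1 := fun i _ _ => ⟨(hb i).1, (hb (i + 1)).1, (hb i).diag⟩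
  obtain ⟨j, hj, hmax⟩ := Finset.exists_max_image (Finset.Ico i0 i1)
    (fun i => (b i).2 + (b (i + 1)).2) ⟨i0, Finset.mem_Ico.2 ⟨le_rfl, hi01⟩⟩
  rw [Finset.mem_Ico] at hj
  -- the two dual vertices across the topmost edge
  obtain ⟨wu, wd, hwu, hwd, hd, hm1, hm2, hu, hd1, hd2⟩ := exists_dual_pair hτ (hb j).1 (hb j).diag
  have hFu : FR b i0 i1 wu = 0 := by
    refine Finset.sum_eq_zero fun i hi => if_neg ?_
    have : (b i).2 + (b (i + 1)).2 ≤ (b j).2 + (b (j + 1)).2 := hmax i hi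
    omega
  have hFd : FR b i0 i1 wd = 1 := by
    have := FR_adj_closed hτ hi01.le hp hc hwd hwu hd
    rw [hFu, add_zero, FH_eq_one hM (fun i _ _ => hb i) hinj hj.1 hj.2 hm1 hm2] at this
    exact this
  have hcol : ∀ w, FR b i0 i1 w = 1 → |w.1| ≤ n ∧ w.2 ≤ -n + k - 2 := by
    intro w hw
    have : ∃ i ∈ Finset.Ico i0 i1, crossR (b i) (b (i + 1)) w ≠ 0 := by
      by_contra! hcon
      rw [FR, Finset.sum_eq_zero hcon] at hw
      exact absurd hw (by decide)
    obtain ⟨i, hi, hne⟩ := this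
    unfold crossR at hne
    split_ifs at hne with hh
    · have h1 := (hb i).2.1
      have h2 := (hb (i + 1)).2.1
      have h3 := hk i
      have h4 := hk (i + 1)
      obtain ⟨k1, h6⟩ := (hb i).1.1
      obtain ⟨k1, h6⟩ := (hb i).1.2.1
      have h5 := (hb i).diag
      unfold Diag at h5
      rw [abs_le] at *
      omega
    · simp at hne
  have hboxd : inBox n wd := by
    refine ⟨(hcol _ hFd).1, ?_⟩
    have h1 := ((hb j).inBox_left hM).2
    have h2 := ((hb (j + 1)).inBox_left hM).2
    rcases hd2 with h | h <;> rw [h] <;> assumption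
  -- the dual walk from the lower one
  let f : ℤ × ℤ → ℤ × ℤ := fun v => if h : ∃ w, Stp M n (-τ) v w then h.choose else v
  have hf : ∀ v, Typ (-τ) v → inBox n v → Stp M n (-τ) v (f v) := by
    intro v hv hB
    have h := exists_stp hM hv hB
    simp only [f, dif_pos h]
    exact h.choose_spec
  let c : ℕ → ℤ × ℤ := fun i => f^[i] wd
  have hcs : ∀ i, c (i + 1) = f (c i) := fun i => Function.iterate_succ_apply' f i wd
  have hinv : ∀ i, Typ (-τ) (c i) ∧ inBox n (c i) ∧ FR b i0 i1 (c i) = 1 := by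
    intro i
    induction i with
    | zero => exact ⟨hwd, hboxd, hFd⟩
    | succ i ihi =>
      obtain ⟨h1, h2, h3⟩ := ihi
      have hs := hf _ h1 h2
      rw [← hcs] at hs
      have h4 : FR b i0 i1 (c (i + 1)) = 1 := by
        have := FR_adj_closed hτ hi01.le hp hc h1 hs.typ_right hs.diag
        rw [FH_eq_zero_of_dual hM hτ (fun i _ _ => hb i) hs] at this
        rw [← zmod2_eq this, h3]
      exact ⟨hs.typ_right, ⟨(hcol _ h4).1, (hs.bounds hM hn).2⟩, h4⟩
  have hstep : ∀ i, Stp M n (-τ) (c i) (c (i + 1)) := by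
    intro i
    rw [hcs]
    exact hf _ (hinv i).1 (hinv i).2.1
  have hk2 : 2 ≤ k := by
    have h1 := (hcol _ (hinv 0).2.2).2
    have h2 := (hinv 0).2.1.2
    rw [abs_le] at h2
    omega
  refine ih (k - 2) (by omega) (-τ) (by omega) c hstep fun i => ?_
  have := (hcol _ (hinv i).2.2).2
  push_cast [hk2]
  omega

end Matching

/-- The lattice point `p` as a point of the plane. -/
def toR (p : ℤ × ℤ) : ℝ × ℝ := ((p.1 : ℝ), (p.2 : ℝ))

/-- The closed `ℓ¹` ball of radius `2` about the lattice point `w`. -/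
def face (w : ℤ × ℤ) : Set (ℝ × ℝ) := {x | |x.1 - w.1| + |x.2 - w.2| ≤ 2}

/-- The closed edge joining two lattice points. -/
def eseg (a b : ℤ × ℤ) : Set (ℝ × ℝ) := segment ℝ (toR a) (toR b)

/-- The lattice vertex with diagonal coordinates `a, b` in the sublattice `τ`. -/
def dvert (τ a b : ℤ) : ℤ × ℤ := (2 * (a + b) + τ, 2 * (a - b))

lemma typ_dvert {τ : ℤ} (hτ : τ = 1 ∨ τ = -1) (a b : ℤ) : Typ τ (dvert τ a b) := by
  refine ⟨?_, ?_, ?_⟩ <;> simp only [dvert, Int.odd_iff, Int.even_iff] <;>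
    rcases hτ with rfl | rfl <;> omega

lemma Typ.exists_dvert {τ : ℤ} (hτ : τ = 1 ∨ τ = -1) {w : ℤ × ℤ} (h : Typ τ w) :
    ∃ a b, w = dvert τ a b := by
  obtain ⟨⟨k1, h1⟩, ⟨k2, h2⟩, h3⟩ := h
  refine ⟨(w.1 + w.2 - τ) / 4, (w.1 - w.2 - τ) / 4, ?_⟩
  unfold dvert
  ext <;> rcases hτ with rfl | rfl <;> dsimp only <;> omega

lemma mem_face_dvert {τ a b : ℤ} {x : ℝ × ℝ} : x ∈ face (dvert τ a b) ↔
    |x.1 + x.2 - (4 * a + τ)| ≤ 2 ∧ |x.1 - x.2 - (4 * b + τ)| ≤ 2 := by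
  have key : ∀ s t : ℝ, |s| + |t| ≤ 2 ↔ |s + t| ≤ 2 ∧ |s - t| ≤ 2 := by
    intro s t
    constructor
    · intro h
      exact ⟨(abs_add_le _ _).trans h, (abs_sub _ _).trans h⟩
    · rintro ⟨h1, h2⟩
      rw [abs_le] at h1 h2
      rcases abs_cases s with h | h <;> rcases abs_cases t with h' | h' <;> linarith
  unfold face dvert
  simp only [Set.mem_ofPred_eq]
  push_cast
  rw [key]
  ring_nf

lemma exists_face {τ : ℤ} (hτ : τ = 1 ∨ τ = -1) (x : ℝ × ℝ) : ∃ w, Typ τ w ∧ x ∈ face w := by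
  refine ⟨dvert τ (round ((x.1 + x.2 - τ) / 4)) (round ((x.1 - x.2 - τ) / 4)),
    typ_dvert hτ _ _, ?_⟩
  rw [mem_face_dvert]
  have h1 := abs_sub_round ((x.1 + x.2 - τ) / 4)
  have h2 := abs_sub_round ((x.1 - x.2 - τ) / 4)
  simp only [abs_le] at *
  refine ⟨⟨?_, ?_⟩, ?_, ?_⟩ <;> linarith

lemma toR_mem_face (w : ℤ × ℤ) : toR w ∈ face w := by
  simp [toR, face]

lemma isClosed_face (w : ℤ × ℤ) : IsClosed (face w) := by
  apply isClosed_le <;> fun_prop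

lemma face_bounds {w : ℤ × ℤ} {x : ℝ × ℝ} (h : x ∈ face w) :
    |x.1 - w.1| ≤ 2 ∧ |x.2 - w.2| ≤ 2 := by
  have h' : |x.1 - w.1| + |x.2 - w.2| ≤ 2 := h
  constructor <;> linarith [abs_nonneg (x.1 - w.1), abs_nonneg (x.2 - w.2)]

lemma isClosed_iUnion_face (P : ℤ × ℤ → Prop) :
    IsClosed (⋃ w : {w // P w}, face w.1) := by
  refine LocallyFinite.isClosed_iUnion (fun x => ⟨Metric.ball x 1, Metric.ball_mem_nhds x one_pos,
    ?_⟩) fun w => isClosed_face _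
  refine Set.Finite.of_finite_image (f := Subtype.val) ((Set.finite_Icc
    ((⌊x.1⌋ - 4, ⌊x.2⌋ - 4) : ℤ × ℤ) (⌊x.1⌋ + 4, ⌊x.2⌋ + 4)).subset ?_) Subtype.val_injective.injOn
  rintro _ ⟨⟨w, _⟩, ⟨y, hy1, hy2⟩, rfl⟩
  obtain ⟨h1, h2⟩ := face_bounds hy1
  rw [Metric.mem_ball, Prod.dist_eq, max_lt_iff, Real.dist_eq, Real.dist_eq] at hy2
  obtain ⟨h3, h4⟩ := hy2
  have h5 := Int.floor_le x.1
  have h6 := Int.lt_floor_add_one x.1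
  have h7 := Int.floor_le x.2
  have h8 := Int.lt_floor_add_one x.2
  rw [abs_le] at h1 h2
  rw [abs_lt] at h3 h4
  refine ⟨⟨?_, ?_⟩, ?_, ?_⟩ <;> dsimp only <;> rify <;> linarith

/-- A function on dual vertices that only changes across edges avoided by the connected set `C`
is constant on the faces meeting `C`. -/
lemma IsPreconnected.face_const {τ : ℤ} (hτ : τ = 1 ∨ τ = -1) {g : ℤ × ℤ → ZMod 2}
    {C : Set (ℝ × ℝ)} (hC : IsPreconnected C)
    (hadj : ∀ w w', Typ τ w → Typ τ w' → Diag w w' → ∀ x ∈ C, x ∈ face w → x ∈ face w' →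
      g w = g w')
    {w w' : ℤ × ℤ} (hw : Typ τ w) (hw' : Typ τ w') {x y : ℝ × ℝ} (hx : x ∈ C) (hxw : x ∈ face w)
    (hy : y ∈ C) (hyw : y ∈ face w') : g w = g w' := by
  have hadj2 : ∀ w w', Typ τ w → Typ τ w' → ∀ x ∈ C, x ∈ face w → x ∈ face w' → g w = g w' := by
    intro w w' hw hw' x hx h h'
    obtain ⟨a, b, rfl⟩ := hw.exists_dvert hτ
    obtain ⟨a', b', rfl⟩ := hw'.exists_dvert hτ
    have h0 := h
    have h0' := h'
    rw [mem_face_dvert] at h h'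
    have hm : x ∈ face (dvert τ a' b) := mem_face_dvert.2 ⟨h'.1, h.2⟩
    have ha : |a - a'| ≤ 1 := by
      have e1 := h.1
      have e2 := h'.1
      simp only [abs_le] at *
      constructor <;> rify <;> linarith
    have hb : |b - b'| ≤ 1 := by
      have e1 := h.2
      have e2 := h'.2
      simp only [abs_le] at *
      constructor <;> rify <;> linarith
    rw [abs_le] at ha hb
    have s1 : g (dvert τ a b) = g (dvert τ a' b) := by
      by_cases he : a = a'
      · rw [he]
      · refine hadj _ _ (typ_dvert hτ _ _) (typ_dvert hτ _ _) ?_ x hx h0 hm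
        unfold Diag dvert; dsimp only; omega
    have s2 : g (dvert τ a' b) = g (dvert τ a' b') := by
      by_cases he : b = b'
      · rw [he]
      · refine hadj _ _ (typ_dvert hτ _ _) (typ_dvert hτ _ _) ?_ x hx hm h0'
        unfold Diag dvert; dsimp only; omega
    exact s1.trans s2
  by_contra hne
  have h := isPreconnected_closed_iff.1 hC
    (⋃ v : {v // Typ τ v ∧ g v = g w}, face v.1) (⋃ v : {v // Typ τ v ∧ g v ≠ g w}, face v.1)
    (isClosed_iUnion_face _) (isClosed_iUnion_face _) ?_ ?_ ?_
  · obtain ⟨z, hz, h1, h2⟩ := h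
    obtain ⟨⟨v, hv, hgv⟩, hzv⟩ := Set.mem_iUnion.1 h1
    obtain ⟨⟨v', hv', hgv'⟩, hzv'⟩ := Set.mem_iUnion.1 h2
    exact hgv' ((hadj2 _ _ hv hv' z hz hzv hzv').symm.trans hgv)
  · intro z _
    obtain ⟨v, hv, hzv⟩ := exists_face hτ z
    by_cases hg : g v = g w
    · exact Or.inl (Set.mem_iUnion.2 ⟨⟨v, hv, hg⟩, hzv⟩)
    · exact Or.inr (Set.mem_iUnion.2 ⟨⟨v, hv, hg⟩, hzv⟩)
  · exact ⟨x, hx, Set.mem_iUnion.2 ⟨⟨w, hw, rfl⟩, hxw⟩⟩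
  · exact ⟨y, hy, Set.mem_iUnion.2 ⟨⟨w', hw', fun h => hne h.symm⟩, hyw⟩⟩

/-- Two adjacent faces meet along the edge that joins the two other vertices. -/
lemma face_inter {w w' : ℤ × ℤ} (hd : Diag w w') {x : ℝ × ℝ} (h : x ∈ face w)
    (h' : x ∈ face w') : x ∈ eseg (w.1, w'.2) (w'.1, w.2) := by
  obtain ⟨h1, h2⟩ := hd
  obtain ⟨x1, x2⟩ := x
  obtain ⟨a, b⟩ := w
  obtain ⟨a', b'⟩ := w'
  have h0 : |x1 - a| + |x2 - b| ≤ 2 := h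
  have h0' : |x1 - a'| + |x2 - b'| ≤ 2 := h'
  dsimp only at h1 h2
  rw [eseg, segment_eq_image]
  refine ⟨|x1 - a| / 2, ⟨by positivity, by linarith [abs_nonneg (x2 - b)]⟩, ?_⟩
  simp only [toR, Prod.smul_mk, smul_eq_mul, Prod.mk_add_mk, Prod.mk.injEq]
  rcases h1 with rfl | rfl <;> rcases h2 with rfl | rfl <;> push_cast at h0' ⊢ <;>
    rcases abs_cases (x1 - a) with e | e <;> rcases abs_cases (x2 - b) with f | f <;>
    (rw [e.1, f.1] at h0; rw [e.1];
     have g1 := neg_abs_le (x1 - a - 2); have g2 := neg_abs_le (x2 - b - 2)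
     have g3 := le_abs_self (x1 - (a - 2)); have g4 := le_abs_self (x2 - (b - 2))
     have g5 := neg_abs_le (x1 - (a + 2)); have g6 := neg_abs_le (x2 - (b + 2))
     constructor <;> linarith)

lemma eseg_comm (a b : ℤ × ℤ) : eseg a b = eseg b a := segment_symm _ _ _

lemma eseg_of_hits {τ : ℤ} (hτ : τ = 1 ∨ τ = -1) {a b w w' : ℤ × ℤ} (ha : Typ τ a)
    (hw : Typ (-τ) w) (hw' : Typ (-τ) w') (hab : Diag a b) (hd : Diag w w')
    (h : hits a b w w' ≠ 0) : eseg a b = eseg (w.1, w'.2) (w'.1, w.2) := by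
  unfold hits at h
  split_ifs at h with hh
  · obtain ⟨a1, a2⟩ := a
    obtain ⟨b1, b2⟩ := b
    obtain ⟨w1, w2⟩ := w
    obtain ⟨w1', w2'⟩ := w'
    obtain ⟨h3, h4⟩ := hd
    obtain ⟨h1, h2⟩ := hab
    have ht := ha.2.2
    have htw := hw.2.2
    have htw' := hw'.2.2
    dsimp only at *
    have : (a1 = w1 ∧ a2 = w2' ∧ b1 = w1' ∧ b2 = w2) ∨
        (a1 = w1' ∧ a2 = w2 ∧ b1 = w1 ∧ b2 = w2') := by
      rcases hτ with rfl | rfl <;> omega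
    rcases this with ⟨rfl, rfl, rfl, rfl⟩ | ⟨rfl, rfl, rfl, rfl⟩
    · rfl
    · exact eseg_comm _ _
  · exact absurd rfl h

/-- `c` compensates, inside `R`, for the endpoint `Z` of a path. -/
def IsCorr (τ : ℤ) (R : Set (ℝ × ℝ)) (Z : ℤ × ℤ) (c : ℤ × ℤ → ZMod 2) : Prop :=
  ∀ w w', Typ (-τ) w → Typ (-τ) w' → w'.1 = w.1 + 2 → (w'.2 = w.2 + 2 ∨ w'.2 = w.2 - 2) →
    ∀ x ∈ R, x ∈ face w → x ∈ face w' → x ≠ toR Z → above Z w' + c w + c w' = 0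

lemma edge_coords {w w' : ℤ × ℤ} (h1 : w'.1 = w.1 + 2) (h2 : w'.2 = w.2 + 2 ∨ w'.2 = w.2 - 2)
    {x : ℝ × ℝ} (h : x ∈ face w) (h' : x ∈ face w') :
    (w.1 : ℝ) ≤ x.1 ∧ x.1 ≤ w.1 + 2 ∧
      (w'.2 = w.2 + 2 ∧ x.2 = w.2 + 2 - (x.1 - w.1) ∨
        w'.2 = w.2 - 2 ∧ x.2 = w.2 - 2 + (x.1 - w.1)) := by
  have h3 := face_inter ⟨Or.inl h1, h2⟩ h h'
  rw [eseg, segment_eq_image] at h3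
  obtain ⟨t, ⟨ht0, ht1⟩, rfl⟩ := h3
  simp only [toR, Prod.smul_mk, smul_eq_mul, Prod.mk_add_mk]
  rw [h1]
  push_cast
  refine ⟨by linarith, by linarith, ?_⟩
  rcases h2 with h2 | h2 <;> rw [h2] <;> push_cast
  · exact Or.inl ⟨rfl, by ring⟩
  · exact Or.inr ⟨rfl, by ring⟩

lemma isCorr_right {τ : ℤ} (hτ : τ = 1 ∨ τ = -1) {R : Set (ℝ × ℝ)} {Z : ℤ × ℤ} (hZ : Typ τ Z)
    (hR : ∀ x ∈ R, x.1 ≤ Z.1) :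
    IsCorr τ R Z fun w => if Z.1 ≤ w.1 ∧ w.2 < Z.2 then 1 else 0 := by
  intro w w' hw hw' h1 h2 x hx h h' hne
  obtain ⟨e1, e2, e3⟩ := edge_coords h1 h2 h h'
  have hwZ : w.1 ≤ Z.1 := by exact_mod_cast e1.trans (hR x hx)
  have hcol : w.1 = Z.1 → w'.2 ≠ Z.2 := by
    intro hc hc2
    have hx1 : x.1 = w.1 := le_antisymm (hc ▸ hR x hx) e1
    refine hne (Prod.ext ?_ ?_) <;> simp only [toR]
    · rw [hx1, hc]
    · rw [← hc2]
      rcases e3 with ⟨e3, e4⟩ | ⟨e3, e4⟩ <;> rw [e4, e3, hx1] <;> push_cast <;> ring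
  obtain ⟨⟨k1, h1a⟩, ⟨k2, h1b⟩, h1c⟩ := hZ
  obtain ⟨⟨k3, h3a⟩, ⟨k4, h3b⟩, h3c⟩ := hw
  clear e1 e2 e3 hne h h' hR hx
  unfold above
  beta_reduce
  rcases hτ with rfl | rfl <;> rcases h2 with h2 | h2 <;>
    split_ifs <;> first | decide | (exfalso; omega)

lemma isCorr_left {τ : ℤ} (hτ : τ = 1 ∨ τ = -1) {R : Set (ℝ × ℝ)} {Z : ℤ × ℤ} (hZ : Typ τ Z)
    (hR : ∀ x ∈ R, Z.1 ≤ x.1) :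
    IsCorr τ R Z fun w => if w.1 < Z.1 ∧ w.2 < Z.2 then 1 else 0 := by
  intro w w' hw hw' h1 h2 x hx h h' hne
  obtain ⟨e1, e2, e3⟩ := edge_coords h1 h2 h h'
  have hwZ : Z.1 ≤ w.1 + 2 := by exact_mod_cast (hR x hx).trans e2
  have hcol : w.1 + 2 = Z.1 → w.2 ≠ Z.2 := by
    intro hc hc2
    have hc' : (w.1 : ℝ) + 2 = Z.1 := by exact_mod_cast hc
    have hx1 : x.1 = w.1 + 2 := le_antisymm e2 (hc' ▸ hR x hx)
    refine hne (Prod.ext ?_ ?_) <;> simp only [toR]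
    · rw [hx1, hc']
    · rw [← hc2]
      rcases e3 with ⟨e3, e4⟩ | ⟨e3, e4⟩ <;> rw [e4, hx1] <;> ring
  obtain ⟨⟨k1, h1a⟩, ⟨k2, h1b⟩, h1c⟩ := hZ
  obtain ⟨⟨k3, h3a⟩, ⟨k4, h3b⟩, h3c⟩ := hw
  clear e1 e2 e3 hne h h' hR hx
  unfold above
  beta_reduce
  rcases hτ with rfl | rfl <;> rcases h2 with h2 | h2 <;>
    split_ifs <;> first | decide | (exfalso; omega)

lemma isCorr_top {τ : ℤ} (hτ : τ = 1 ∨ τ = -1) {R : Set (ℝ × ℝ)} {Z : ℤ × ℤ} (hZ : Typ τ Z)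
    (hR : ∀ x ∈ R, x.2 ≤ Z.2) : IsCorr τ R Z fun w => if Z.1 ≤ w.1 then 1 else 0 := by
  intro w w' hw hw' h1 h2 x hx h h' hne
  obtain ⟨e1, e2, e3⟩ := edge_coords h1 h2 h h'
  have h3 := hR x hx
  have hle : min w.2 w'.2 ≤ Z.2 := by
    rify
    refine le_trans ?_ h3
    rcases e3 with ⟨e3, e4⟩ | ⟨e3, e4⟩ <;> rw [e4, e3] <;> push_cast
    · exact (min_le_left _ _).trans (by linarith)
    · exact (min_le_right _ _).trans (by linarith)
  have hcol : w'.1 = Z.1 → w'.2 ≠ Z.2 := by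
    intro hc hc2
    exact hw'.disjoint (by omega) (by rw [neg_neg]; exact Prod.ext hc hc2 ▸ hZ)
  have hcol' : w.1 + 2 = Z.1 → w.2 = Z.2 → w'.2 ≠ w.2 + 2 := by
    intro hc hc2 hc3
    have hc' : (w.1 : ℝ) + 2 = Z.1 := by exact_mod_cast hc
    rcases e3 with ⟨e3, e4⟩ | ⟨e3, e4⟩
    · rw [← hc2] at h3
      refine hne (Prod.ext ?_ ?_) <;> simp only [toR]
      · linarith
      · rw [← hc2]; linarith
    · omega
  obtain ⟨⟨k1, h1a⟩, ⟨k2, h1b⟩, h1c⟩ := hZ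
  obtain ⟨⟨k3, h3a⟩, ⟨k4, h3b⟩, h3c⟩ := hw
  clear e1 e2 e3 hne h h' hR hx
  unfold above
  beta_reduce
  rcases hτ with rfl | rfl <;> rcases h2 with h2 | h2 <;>
    split_ifs <;> first | decide | (exfalso; omega)

lemma isCorr_bot {τ : ℤ} (hτ : τ = 1 ∨ τ = -1) {R : Set (ℝ × ℝ)} {Z : ℤ × ℤ} (hZ : Typ τ Z)
    (hR : ∀ x ∈ R, (Z.2 : ℝ) ≤ x.2) : IsCorr τ R Z fun _ => 0 := by
  intro w w' hw hw' h1 h2 x hx h h' hne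
  obtain ⟨e1, e2, e3⟩ := edge_coords h1 h2 h h'
  have h3 := hR x hx
  rw [add_zero, add_zero]
  refine if_neg fun hh => ?_
  obtain ⟨hc, hlt⟩ := hh
  have hle : Z.2 ≤ max w.2 w'.2 := by
    rify
    refine h3.trans ?_
    rcases e3 with ⟨e3, e4⟩ | ⟨e3, e4⟩ <;> rw [e4, e3] <;> push_cast
    · exact le_trans (by linarith) (le_max_right _ _)
    · exact le_trans (by linarith) (le_max_left _ _)
  have hcol' : w.2 = Z.2 → w'.2 ≠ w.2 - 2 := by
    intro hc2 hc3
    have hc' : (w.1 : ℝ) + 2 = Z.1 := by rw [hc, h1]; push_cast; ring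
    rcases e3 with ⟨e3, e4⟩ | ⟨e3, e4⟩
    · omega
    · rw [← hc2] at h3
      refine hne (Prod.ext ?_ ?_) <;> simp only [toR]
      · linarith
      · rw [← hc2]; linarith
  obtain ⟨⟨k1, h1a⟩, ⟨k2, h1b⟩, h1c⟩ := hZ
  obtain ⟨⟨k3, h3a⟩, ⟨k4, h3b⟩, h3c⟩ := hw
  clear e1 e2 e3 hne h h' hR hx
  rcases hτ with rfl | rfl <;> rcases h2 with h2 | h2 <;> omega

section Separation

variable {τ : ℤ} {p : ℕ → ℤ × ℤ} {i0 i1 : ℕ} {R : Set (ℝ × ℝ)} {c0 c1 : ℤ × ℤ → ZMod 2}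

/-- The corrected crossing parity. -/
def gpar (p : ℕ → ℤ × ℤ) (i0 i1 : ℕ) (c0 c1 : ℤ × ℤ → ZMod 2) (w : ℤ × ℤ) : ZMod 2 :=
  FR p i0 i1 w + c0 w + c1 w

lemma gpar_adj (hτ : τ = 1 ∨ τ = -1) (h01 : i0 ≤ i1) (hp : LPath τ p i0 i1)
    (hc0 : IsCorr τ R (p i0) c0) (hc1 : IsCorr τ R (p i1) c1) {w w' : ℤ × ℤ}
    (hw : Typ (-τ) w) (hw' : Typ (-τ) w') (hd : Diag w w') {x : ℝ × ℝ} (hx : x ∈ R)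
    (hxw : x ∈ face w) (hxw' : x ∈ face w') (h0 : x ≠ toR (p i0)) (h1 : x ≠ toR (p i1)) :
    gpar p i0 i1 c0 c1 w + gpar p i0 i1 c0 c1 w' = FH p i0 i1 w w' := by
  unfold gpar
  obtain ⟨hd1 | hd1, hd2⟩ := hd
  · have e1 := FR_adj hτ h01 hp hw hw' hd1 hd2
    have e2 := hc0 w w' hw hw' hd1 hd2 x hx hxw hxw' h0
    have e3 := hc1 w w' hw hw' hd1 hd2 x hx hxw hxw' h1
    linear_combination e1 + e2 + e3
  · have e1 := FR_adj hτ h01 hp hw' hw (by omega) (by omega)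
    have e2 := hc0 w' w hw' hw (by omega) (by omega) x hx hxw' hxw h0
    have e3 := hc1 w' w hw' hw (by omega) (by omega) x hx hxw' hxw h1
    rw [FH_comm]
    linear_combination e1 + e2 + e3

lemma gpar_const (hτ : τ = 1 ∨ τ = -1) (h01 : i0 < i1) (hp : LPath τ p i0 i1)
    (hc0 : IsCorr τ R (p i0) c0) (hc1 : IsCorr τ R (p i1) c1) {C : Set (ℝ × ℝ)}
    (hC : IsPreconnected C) (hCR : C ⊆ R)
    (hdis : ∀ i, i0 ≤ i → i < i1 → Disjoint C (eseg (p i) (p (i + 1)))) {w w' : ℤ × ℤ}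
    (hw : Typ (-τ) w) (hw' : Typ (-τ) w') {x y : ℝ × ℝ} (hx : x ∈ C) (hxw : x ∈ face w)
    (hy : y ∈ C) (hyw : y ∈ face w') : gpar p i0 i1 c0 c1 w = gpar p i0 i1 c0 c1 w' := by
  refine IsPreconnected.face_const (τ := -τ) (by omega) hC ?_ hw hw' hx hxw hy hyw
  intro a b ha hb hd z hz hza hzb
  refine zmod2_eq ?_
  rw [gpar_adj hτ h01.le hp hc0 hc1 ha hb hd (hCR hz) hza hzb]
  · refine Finset.sum_eq_zero fun i hi => ?_
    rw [Finset.mem_Ico] at hi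
    by_contra hne
    have hh := hp i hi.1 hi.2
    have := eseg_of_hits hτ hh.1 ha hb hh.2.2 hd hne
    exact Set.disjoint_left.1 (hdis i hi.1 hi.2) hz (this ▸ face_inter hd hza hzb)
  · rintro rfl
    exact Set.disjoint_left.1 (hdis i0 le_rfl h01) hz (left_mem_segment _ _ _)
  · rintro rfl
    have := hdis (i1 - 1) (by omega) (by omega)
    rw [show i1 - 1 + 1 = i1 by omega] at this
    exact Set.disjoint_left.1 this hz (right_mem_segment _ _ _)

end Separation

/-- Source vertices, for both sublattices at once. -/
def Src (n τ : ℤ) (v : ℤ × ℤ) : Prop := Typ τ v ∧ |v.1| ≤ n ∧ |v.2| = n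

/-- A forest path absorbed when leaving the box, for both sublattices at once. -/
def IsPth (M : Set ((ℤ × ℤ) × (ℤ × ℤ))) (n τ : ℤ) (u : ℤ × ℤ) (p : ℕ → ℤ × ℤ) : Prop :=
  p 0 = u ∧ ∀ i, Stp M n τ (p i) (p (i + 1)) ∨ (¬|(p i).1| ≤ n ∧ p (i + 1) = p i)

/-- The backbone, for both sublattices at once. -/
def BB (M : Set ((ℤ × ℤ) × (ℤ × ℤ))) (n τ : ℤ) : Set (ℤ × ℤ) :=
  {w | ∃ v, Src n τ v ∧ Relation.ReflTransGen (Stp M n τ) v w}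

/-- The path `p` is a genuine forest path up to time `T` and stays put afterwards. -/
structure Absorbed (M : Set ((ℤ × ℤ) × (ℤ × ℤ))) (n τ : ℤ) (p : ℕ → ℤ × ℤ) (T : ℕ) : Prop where
  pos : 0 < T
  stp : ∀ i < T, Stp M n τ (p i) (p (i + 1))
  out : ¬|(p T).1| ≤ n
  const : ∀ i, T ≤ i → p i = p T

/-- The plane curve traced by a lattice path. -/
def curve (p : ℕ → ℤ × ℤ) : Set (ℝ × ℝ) := ⋃ i, eseg (p i) (p (i + 1))

/-- The rectangle containing all forest paths. -/
def bigBox (n : ℤ) : Set (ℝ × ℝ) := {x | |x.1| ≤ n + 1 ∧ |x.2| ≤ n}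

lemma left_mem_eseg (a b : ℤ × ℤ) : toR a ∈ eseg a b := left_mem_segment _ _ _

lemma right_mem_eseg (a b : ℤ × ℤ) : toR b ∈ eseg a b := right_mem_segment _ _ _

lemma isPreconnected_eseg (a b : ℤ × ℤ) : IsPreconnected (eseg a b) :=
  (convex_segment _ _).isPreconnected

lemma isPreconnected_curve (p : ℕ → ℤ × ℤ) : IsPreconnected (curve p) :=
  IsPreconnected.iUnion_of_chain (fun _ => isPreconnected_eseg _ _)
    fun _ => ⟨_, right_mem_eseg _ _, left_mem_eseg _ _⟩

lemma toR_mem_curve (p : ℕ → ℤ × ℤ) (i : ℕ) : toR (p i) ∈ curve p :=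
  Set.mem_iUnion.2 ⟨i, left_mem_eseg _ _⟩

lemma convex_bigBox (n : ℤ) : Convex ℝ (bigBox n) := by
  intro x hx y hy a b ha hb hab
  obtain ⟨h1, h2⟩ := hx
  obtain ⟨h3, h4⟩ := hy
  rw [abs_le] at h1 h2 h3 h4
  have hb' : b = 1 - a := by linarith
  subst hb'
  constructor <;> rw [abs_le] <;>
    simp only [Prod.fst_add, Prod.snd_add, Prod.smul_fst, Prod.smul_snd, smul_eq_mul] <;>
    constructor <;> nlinarith

section Paths

variable {n : ℤ} {M : Set ((ℤ × ℤ) × (ℤ × ℤ))} {τ : ℤ} {p : ℕ → ℤ × ℤ} {T : ℕ}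

lemma IsPth.exists_absorbed (hM : IsAztecMatching n M) (hn : (4 : ℤ) ∣ n) (h0 : 0 ≤ n)
    (hτ : τ = 1 ∨ τ = -1) {u : ℤ × ℤ} (hu : Src n τ u) (hp : IsPth M n τ u p) :
    ∃ T, Absorbed M n τ p T := by
  have hex : ∃ i, ¬|(p i).1| ≤ n := by
    by_contra! hcon
    have hs : ∀ i, Stp M n τ (p i) (p (i + 1)) := fun i =>
      (hp.2 i).resolve_right fun h => h.1 (hcon i)
    refine no_infinite_walk hM hn (2 * n).toNat τ hτ p hs fun i => ?_
    have := ((hs i).inBox_left hM).2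
    rw [abs_le] at this
    omega
  have hlt : ∀ i < Nat.find hex, |(p i).1| ≤ n := fun i hi => not_not.1 (Nat.find_min hex hi)
  refine ⟨Nat.find hex, ?_, fun i hi => ?_, Nat.find_spec hex, fun i hi => ?_⟩
  · rw [Nat.find_pos, not_not, hp.1]
    exact hu.2.1
  · exact (hp.2 i).resolve_right fun h => h.1 (hlt i hi)
  · induction i, hi using Nat.le_induction with
    | base => rfl
    | succ k hk ih =>
      rcases hp.2 k with h | h
      · exact absurd h.2.1 (ih ▸ Nat.find_spec hex)
      · rw [h.2, ih]

lemma Absorbed.inj (hM : IsAztecMatching n M) (h : Absorbed M n τ p T) {i j : ℕ} (hi : i < T)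
    (hj : j < T) (he : p i = p j) : i = j := by
  have key : ∀ i j, i < j → j < T → p i = p j → False := by
    intro i j hij hj he
    have hk : ∀ k, j + k ≤ T → p (i + k) = p (j + k) := by
      intro k
      induction k with
      | zero => intro _; exact he
      | succ k ih =>
        intro hk
        have h1 := h.stp (i + k) (by omega)
        have h2 := h.stp (j + k) (by omega)
        rw [ih (by omega)] at h1
        exact h1.functional hM h2
    have h1 := hk (T - j) (by omega)
    rw [show j + (T - j) = T by omega] at h1
    exact h.out (h1 ▸ (h.stp (i + (T - j)) (by omega)).2.1)
  rcases lt_trichotomy i j with hlt | he' | hlt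
  · exact (key i j hlt hj he).elim
  · exact he'
  · exact (key j i hlt hi he.symm).elim

lemma Absorbed.mem_curve (h : Absorbed M n τ p T) {x : ℝ × ℝ} (hx : x ∈ curve p) :
    ∃ i < T, x ∈ eseg (p i) (p (i + 1)) := by
  obtain ⟨i, hi⟩ := Set.mem_iUnion.1 hx
  by_cases hiT : i < T
  · exact ⟨i, hiT, hi⟩
  · refine ⟨T - 1, by have := h.pos; omega, ?_⟩
    rw [h.const i (by omega), h.const (i + 1) (by omega), eseg, segment_same] at hi
    rw [hi, Nat.sub_add_cancel h.pos]
    exact right_mem_eseg _ _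

lemma Stp.eseg_subset (hM : IsAztecMatching n M) (hn : (4 : ℤ) ∣ n) {a b : ℤ × ℤ}
    (h : Stp M n τ a b) : eseg a b ⊆ bigBox n := by
  obtain ⟨h1, h2⟩ := h.inBox_left hM
  obtain ⟨h3, h4⟩ := h.bounds hM hn
  refine (convex_bigBox n).segment_subset ⟨?_, ?_⟩ ⟨?_, ?_⟩ <;> simp only [toR] <;>
    exact_mod_cast (by omega)

lemma Absorbed.curve_subset (hM : IsAztecMatching n M) (hn : (4 : ℤ) ∣ n)
    (h : Absorbed M n τ p T) : curve p ⊆ bigBox n := by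
  intro x hx
  obtain ⟨i, hi, hxi⟩ := h.mem_curve hx
  exact (h.stp i hi).eseg_subset hM hn hxi

lemma eseg_coords {a b : ℤ × ℤ} {x : ℝ × ℝ} (hx : x ∈ eseg a b) :
    ((min (a.1 + a.2) (b.1 + b.2) : ℤ) : ℝ) ≤ x.1 + x.2 ∧
    x.1 + x.2 ≤ ((max (a.1 + a.2) (b.1 + b.2) : ℤ) : ℝ) ∧
    ((min (a.1 - a.2) (b.1 - b.2) : ℤ) : ℝ) ≤ x.1 - x.2 ∧
    x.1 - x.2 ≤ ((max (a.1 - a.2) (b.1 - b.2) : ℤ) : ℝ) := by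
  rw [eseg, segment_eq_image] at hx
  obtain ⟨t, ⟨ht0, ht1⟩, rfl⟩ := hx
  simp only [toR, Prod.smul_mk, smul_eq_mul, Prod.mk_add_mk]
  push_cast
  have e1 := min_le_left ((a.1 : ℝ) + a.2) (b.1 + b.2)
  have e2 := min_le_right ((a.1 : ℝ) + a.2) (b.1 + b.2)
  have e3 := le_max_left ((a.1 : ℝ) + a.2) (b.1 + b.2)
  have e4 := le_max_right ((a.1 : ℝ) + a.2) (b.1 + b.2)
  have e5 := min_le_left ((a.1 : ℝ) - a.2) (b.1 - b.2)
  have e6 := min_le_right ((a.1 : ℝ) - a.2) (b.1 - b.2)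
  have e7 := le_max_left ((a.1 : ℝ) - a.2) (b.1 - b.2)
  have e8 := le_max_right ((a.1 : ℝ) - a.2) (b.1 - b.2)
  have hs : 0 ≤ 1 - t := by linarith
  refine ⟨?_, ?_, ?_, ?_⟩
  · linarith [mul_le_mul_of_nonneg_left e1 hs, mul_le_mul_of_nonneg_left e2 ht0]
  · linarith [mul_le_mul_of_nonneg_left e3 hs, mul_le_mul_of_nonneg_left e4 ht0]
  · linarith [mul_le_mul_of_nonneg_left e5 hs, mul_le_mul_of_nonneg_left e6 ht0]
  · linarith [mul_le_mul_of_nonneg_left e7 hs, mul_le_mul_of_nonneg_left e8 ht0]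

/-- Edges of the two forests do not meet. -/
lemma Stp.disjoint_eseg (hM : IsAztecMatching n M) (hτ : τ = 1 ∨ τ = -1) {a b w w' : ℤ × ℤ}
    (h : Stp M n τ a b) (h_dual : Stp M n (-τ) w w') : Disjoint (eseg a b) (eseg w w') := by
  rw [Set.disjoint_left]
  intro x hx hx'
  obtain ⟨e1, e2, e3, e4⟩ := eseg_coords hx
  obtain ⟨f1, f2, f3, f4⟩ := eseg_coords hx'
  have g1 := Int.cast_le.1 (e1.trans f2)
  have g2 := Int.cast_le.1 (f1.trans e2)
  have g3 := Int.cast_le.1 (e3.trans f4)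
  have g4 := Int.cast_le.1 (f3.trans e4)
  clear e1 e2 e3 e4 f1 f2 f3 f4
  have hmid : a.1 + b.1 = w.1 + w'.1 ∧ a.2 + b.2 = w.2 + w'.2 := by
    obtain ⟨k1, h1⟩ := h.1.1
    obtain ⟨k2, h2⟩ := h.1.2.1
    have h3 := h.1.2.2
    obtain ⟨k3, h4⟩ := h_dual.1.1
    obtain ⟨k4, h5⟩ := h_dual.1.2.1
    have h6 := h_dual.1.2.2
    obtain ⟨h7 | h7, h8 | h8⟩ := h.diag <;> obtain ⟨h9 | h9, h10 | h10⟩ := h_dual.diag <;>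
      rcases hτ with rfl | rfl <;> omega
  have := h.midpoint_inj hM h_dual hmid.1 hmid.2
  exact h.1.disjoint hτ (this ▸ h_dual.1)

/-- The vertices `z` and `w` differ by `2` in exactly one coordinate. -/
def Axis (z w : ℤ × ℤ) : Prop :=
  (w.1 = z.1 ∧ (w.2 = z.2 + 2 ∨ w.2 = z.2 - 2)) ∨ (w.2 = z.2 ∧ (w.1 = z.1 + 2 ∨ w.1 = z.1 - 2))

lemma Axis.typ {z w : ℤ × ℤ} (hτ : τ = 1 ∨ τ = -1) (hz : Typ τ z) (h : Axis z w) :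
    Typ (-τ) w := by
  obtain ⟨⟨k1, h1⟩, ⟨k2, h2⟩, h3⟩ := hz
  unfold Axis at h
  refine ⟨?_, ?_, ?_⟩
  · rw [Int.odd_iff]; omega
  · rw [Int.even_iff]; omega
  · rcases hτ with rfl | rfl <;> omega

/-- A connector between adjacent vertices of the two sublattices meets the edges of a sublattice
only at its own vertex of that sublattice. -/
lemma Axis.eseg_inter {z w a b : ℤ × ℤ} (hzw : Axis z w) (hz : Typ τ z) (ha : Typ τ a)
    (hab : Diag a b) {x : ℝ × ℝ} (hx : x ∈ eseg z w) (hx' : x ∈ eseg a b) : x = toR z := by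
  have hk : ∃ k : ℤ, x.1 + x.2 = z.1 + z.2 + 4 * k ∨ x.1 - x.2 = z.1 - z.2 + 4 * k := by
    obtain ⟨e1, e2, e3, e4⟩ := eseg_coords hx'
    obtain ⟨k1, h1⟩ := hz.2.2
    obtain ⟨k2, h2⟩ := ha.2.2
    obtain ⟨k3, h3⟩ := hz.2.1
    obtain ⟨k4, h4⟩ := ha.2.1
    have : a.1 + a.2 = b.1 + b.2 ∨ a.1 - a.2 = b.1 - b.2 := by
      unfold Diag at hab; omega
    rcases this with h | h
    · rw [h, min_self] at e1
      rw [h, max_self] at e2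
      refine ⟨k2 - k1, Or.inl ?_⟩
      have : b.1 + b.2 = z.1 + z.2 + 4 * (k2 - k1) := by omega
      rw [le_antisymm e2 e1, this]
      push_cast; ring
    · rw [h, min_self] at e3
      rw [h, max_self] at e4
      refine ⟨k2 - k1 + k3 - k4, Or.inr ?_⟩
      have : b.1 - b.2 = z.1 - z.2 + 4 * (k2 - k1 + k3 - k4) := by omega
      rw [le_antisymm e4 e3, this]
      push_cast; ring
  rw [eseg, segment_eq_image] at hx
  obtain ⟨t, ⟨ht0, ht1⟩, rfl⟩ := hx
  obtain ⟨k, hk⟩ := hk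
  simp only [toR, Prod.smul_mk, smul_eq_mul, Prod.mk_add_mk] at hk
  have ht : t = 0 := by
    have hk0 : (k : ℝ) = 0 → t = 0 := by
      intro h0
      rw [h0] at hk
      rcases hzw with ⟨h1, h2 | h2⟩ | ⟨h1, h2 | h2⟩ <;> rw [h1, h2] at hk <;> push_cast at hk <;>
        rcases hk with hk | hk <;> linarith
    apply hk0
    have : |(k : ℝ)| < 1 := by
      rw [abs_lt]
      rcases hzw with ⟨h1, h2 | h2⟩ | ⟨h1, h2 | h2⟩ <;> rw [h1, h2] at hk <;> push_cast at hk <;>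
        rcases hk with hk | hk <;> constructor <;> linarith
    have : |k| < 1 := by exact_mod_cast this
    rw [Int.abs_lt_one_iff] at this
    exact_mod_cast this
  simp [ht]

lemma interp_eq {t : ℝ} {i : ℕ} (h0 : (i : ℝ) ≤ t) (h1 : t ≤ i + 1) : interp p t =
    ((p i).1 + (t - i) * ((p (i + 1)).1 - (p i).1), (p i).2 + (t - i) * ((p (i + 1)).2 - (p i).2))
    := by
  rcases h1.lt_or_eq with h1 | rfl
  · have : ⌊t⌋₊ = i := (Nat.floor_eq_iff (le_trans (Nat.cast_nonneg i) h0)).2 ⟨h0, h1⟩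
    unfold interp
    rw [this]
    ext <;> dsimp only <;> ring
  · have : ⌊(i : ℝ) + 1⌋₊ = i + 1 := by exact_mod_cast Nat.floor_natCast (R := ℝ) (i + 1)
    unfold interp
    rw [this]
    push_cast
    ext <;> dsimp only <;> ring

lemma interp_mem_eseg {t : ℝ} {i : ℕ} (h0 : (i : ℝ) ≤ t) (h1 : t ≤ i + 1) :
    interp p t ∈ eseg (p i) (p (i + 1)) := by
  rw [interp_eq h0 h1, eseg, segment_eq_image]
  refine ⟨t - i, ⟨by linarith, by linarith⟩, ?_⟩
  simp only [toR, Prod.smul_mk, smul_eq_mul, Prod.mk_add_mk]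
  ext <;> dsimp only <;> ring

lemma exists_interp {i : ℕ} {x : ℝ × ℝ} (hx : x ∈ eseg (p i) (p (i + 1))) :
    ∃ t : ℝ, (i : ℝ) ≤ t ∧ t ≤ i + 1 ∧ interp p t = x := by
  rw [eseg, segment_eq_image] at hx
  obtain ⟨t, ⟨ht0, ht1⟩, rfl⟩ := hx
  refine ⟨i + t, by linarith, by linarith, ?_⟩
  rw [interp_eq (by linarith) (by linarith)]
  simp only [toR, Prod.smul_mk, smul_eq_mul, Prod.mk_add_mk]
  ext <;> dsimp only <;> ring

lemma interp_nat (p : ℕ → ℤ × ℤ) (i : ℕ) : interp p i = toR (p i) := by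
  rw [interp_eq le_rfl (by linarith)]
  simp [toR]

lemma interp_mem_curve {t : ℝ} (ht : 0 ≤ t) : interp p t ∈ curve p :=
  Set.mem_iUnion.2 ⟨⌊t⌋₊, interp_mem_eseg (Nat.floor_le ht) (Nat.lt_floor_add_one t).le⟩

lemma Absorbed.interp_const (h : Absorbed M n τ p T) {t : ℝ} (ht : (T : ℝ) ≤ t) :
    interp p t = toR (p T) := by
  have h0 : (0 : ℝ) ≤ t := le_trans (Nat.cast_nonneg T) ht
  have hT : T ≤ ⌊t⌋₊ := Nat.le_floor ht
  rw [interp_eq (Nat.floor_le h0) (Nat.lt_floor_add_one t).le, h.const _ hT,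
    h.const (⌊t⌋₊ + 1) (by omega)]
  simp [toR]

lemma Absorbed.disjoint_curve (hM : IsAztecMatching n M) (hτ : τ = 1 ∨ τ = -1)
    {p' : ℕ → ℤ × ℤ} {T' : ℕ} (h : Absorbed M n τ p T) (h' : Absorbed M n (-τ) p' T') :
    Disjoint (curve p) (curve p') := by
  rw [Set.disjoint_left]
  intro x hx hx'
  obtain ⟨i, hi, hxi⟩ := h.mem_curve hx
  obtain ⟨j, hj, hxj⟩ := h'.mem_curve hx'
  exact Set.disjoint_left.1 ((h.stp i hi).disjoint_eseg hM hτ (h'.stp j hj)) hxi hxj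

/-- A vertex of the other sublattice does not lie on an edge. -/
lemma Stp.toR_notMem_eseg (hτ : τ = 1 ∨ τ = -1) {a b : ℤ × ℤ} (hs : Stp M n τ a b) {w : ℤ × ℤ}
    (hw : Typ (-τ) w) : toR w ∉ eseg a b := by
  intro hx
  obtain ⟨e1, e2, e3, e4⟩ := eseg_coords hx
  simp only [toR] at e1 e2 e3 e4
  have g1 : min (a.1 + a.2) (b.1 + b.2) ≤ w.1 + w.2 := by exact_mod_cast e1
  have g2 : w.1 + w.2 ≤ max (a.1 + a.2) (b.1 + b.2) := by exact_mod_cast e2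
  have g3 : min (a.1 - a.2) (b.1 - b.2) ≤ w.1 - w.2 := by exact_mod_cast e3
  have g4 : w.1 - w.2 ≤ max (a.1 - a.2) (b.1 - b.2) := by exact_mod_cast e4
  clear e1 e2 e3 e4 hx
  obtain ⟨k1, h1⟩ := hs.1.1
  obtain ⟨k2, h2⟩ := hs.1.2.1
  have h3 := hs.1.2.2
  obtain ⟨k3, h4⟩ := hw.1
  obtain ⟨k4, h5⟩ := hw.2.1
  have h6 := hw.2.2
  obtain ⟨h7 | h7, h8 | h8⟩ := hs.diag <;> rcases hτ with rfl | rfl <;> omega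

lemma Absorbed.toR_notMem_curve (hτ : τ = 1 ∨ τ = -1)
    (h : Absorbed M n τ p T) {w : ℤ × ℤ} (hw : Typ (-τ) w) : toR w ∉ curve p := by
  intro hx
  obtain ⟨i, hi, hxi⟩ := h.mem_curve hx
  exact (h.stp i hi).toR_notMem_eseg hτ hw hxi

lemma BB.exists_path (hM : IsAztecMatching n M) {Γ : ℤ × ℤ → ℕ → ℤ × ℤ}
    (hΓ : ∀ u, Src n τ u → IsPth M n τ u (Γ u)) {z : ℤ × ℤ} (hz : z ∈ BB M n τ) :
    ∃ u i, Src n τ u ∧ Γ u i = z := by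
  obtain ⟨u, hu, hr⟩ := hz
  refine ⟨u, ?_⟩
  induction hr with
  | refl => exact ⟨0, hu, (hΓ u hu).1⟩
  | tail _ hs ih =>
    obtain ⟨i, -, hi⟩ := ih
    refine ⟨i + 1, hu, ?_⟩
    rcases (hΓ u hu).2 i with h | h
    · exact (hi ▸ h).functional hM hs
    · exact absurd hs.2.1 (hi ▸ h.1)

end Paths

/-- The part of the path `p` with indices in `[i0, i1)` crosses the vertical strip of half-width
`r` about the abscissa `c`, from its side `σ` to its side `-σ`, and its trace in the strip is
contained in `π`. -/
structure Cross (p : ℕ → ℤ × ℤ) (c r σ : ℝ) (i0 i1 : ℕ) (π : Set (ℝ × ℝ)) : Prop where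
  lt : i0 < i1
  start : r ≤ σ * ((p i0).1 - c)
  finish : σ * ((p i1).1 - c) ≤ -r
  inside : ∀ i, i0 ≤ i → i < i1 → ∀ x ∈ eseg (p i) (p (i + 1)), |x.1 - c| ≤ r → x ∈ π

section Crossing

variable {n : ℤ} {M : Set ((ℤ × ℤ) × (ℤ × ℤ))} {τ : ℤ} {p : ℕ → ℤ × ℤ} {T : ℕ}
  {c r σ : ℝ} {i0 i1 j0 j1 : ℕ} {π π' : Set (ℝ × ℝ)}

lemma Absorbed.exists_cross (h : Absorbed M n τ p T) (hr : 0 < r) (hσ : σ = 1 ∨ σ = -1)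
    {s t : ℝ} (h0 : 0 ≤ s) (hst : s ≤ t) (htT : t ≤ T)
    (hsub : ∀ t' ∈ Set.Icc s t, |(interp p t').1 - c| ≤ r)
    (hs : (interp p s).1 = c + σ * r) (ht : (interp p t).1 = c - σ * r) :
    ∃ i0 i1 : ℕ, (i0 : ℝ) ≤ s ∧ s < i0 + 1 ∧ t ≤ i1 ∧ i1 < t + 1 ∧ i1 ≤ T ∧
      Cross p c r σ i0 i1 (interp p '' Set.Icc s t) := by
  have hσ2 : σ * σ = 1 := by rcases hσ with rfl | rfl <;> norm_num
  have hσr : ∀ y : ℝ, |y| ≤ r → -r ≤ σ * y ∧ σ * y ≤ r := by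
    intro y hy
    rw [abs_le] at hy
    rcases hσ with rfl | rfl <;> constructor <;> linarith
  have hne : s ≠ t := by
    rintro rfl
    rw [hs] at ht
    have : σ * r * σ = 0 := by
      have : σ * r = 0 := by linarith
      rw [this, zero_mul]
    nlinarith
  have hlt : s < t := lt_of_le_of_ne hst hne
  have hdiag : ∀ i < T, ((p (i + 1)).1 : ℝ) - (p i).1 ≠ 0 := by
    intro i hi he
    have : (p (i + 1)).1 = (p i).1 := by exact_mod_cast sub_eq_zero.1 he
    have := (h.stp i hi).diag.1
    omega
  have f1 := Nat.floor_le h0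
  have f2 := Nat.lt_floor_add_one s
  have f3 := Nat.le_ceil t
  have f4 := Nat.ceil_lt_add_one (h0.trans hst)
  generalize ⌊s⌋₊ = a at f1 f2
  generalize hb : ⌈t⌉₊ = b at f3 f4
  have hbT : b ≤ T := hb ▸ Nat.ceil_le.2 htT
  have hab : a < b := by exact_mod_cast f1.trans_lt (hlt.trans_le f3)
  obtain ⟨b', rfl⟩ : ∃ b', b = b' + 1 := ⟨b - 1, by omega⟩
  push_cast at f3 f4
  have hs' : σ * ((interp p s).1 - c) = r := by rw [hs]; linear_combination r * hσ2
  have ht' : σ * ((interp p t).1 - c) = -r := by rw [ht]; linear_combination -r * hσ2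
  -- the path enters the strip along its first edge
  have hd0 : σ * ((p (a + 1)).1 - (p a).1) ≤ 0 := by
    have e1 : s < min t (a + 1) := lt_min hlt f2
    have e2 := (hσr _ (hsub (min t (a + 1)) ⟨e1.le, min_le_left _ _⟩)).2
    rw [interp_eq (f1.trans e1.le) (min_le_right _ _)] at e2
    rw [interp_eq f1 f2.le] at hs'
    dsimp only at e2 hs'
    by_contra! hcon
    nlinarith
  have hd1 : σ * ((p (b' + 1)).1 - (p b').1) ≤ 0 := by
    have e1 : max s b' < t := max_lt hlt (by linarith)
    have e2 := (hσr _ (hsub (max s b') ⟨le_max_left _ _, e1.le⟩)).1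
    rw [interp_eq (le_max_right _ _) (e1.le.trans f3)] at e2
    rw [interp_eq (by linarith) f3] at ht'
    dsimp only at e2 ht'
    by_contra! hcon
    nlinarith
  refine ⟨a, b' + 1, f1, f2, by push_cast; exact f3, by push_cast; linarith, hbT,
    ⟨hab, ?_, ?_, ?_⟩⟩
  · rw [interp_eq f1 f2.le] at hs'
    dsimp only at hs'
    nlinarith
  · rw [interp_eq (by linarith) f3] at ht'
    dsimp only at ht'
    nlinarith
  · intro i hi hi' x hx hxr
    obtain ⟨t', e1, e2, rfl⟩ := exists_interp hx
    have hb1 := hσr _ hxr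
    have hai : (a : ℝ) ≤ i := by exact_mod_cast hi
    have hib : (i : ℝ) ≤ b' := by exact_mod_cast (by omega : i ≤ b')
    refine ⟨t', ⟨?_, ?_⟩, rfl⟩
    · by_contra! hcon
      have : i = a := by
        have : i < a + 1 := by exact_mod_cast e1.trans_lt (hcon.trans f2)
        omega
      subst this
      rw [interp_eq e1 e2] at hb1
      rw [interp_eq f1 f2.le] at hs'
      dsimp only at hb1 hs'
      have : σ * ((p (i + 1)).1 - (p i).1) = 0 := by
        refine le_antisymm hd0 ?_
        by_contra! h3
        nlinarith
      have h4 := hdiag i (by omega)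
      rcases hσ with rfl | rfl
      · exact h4 (by linarith)
      · exact h4 (by linarith)
    · by_contra! hcon
      have : i = b' := by
        have : (b' : ℝ) < i + 1 := by linarith
        have : b' < i + 1 := by exact_mod_cast this
        omega
      subst this
      rw [interp_eq e1 e2] at hb1
      rw [interp_eq (by linarith) f3] at ht'
      dsimp only at hb1 ht'
      have : σ * ((p (i + 1)).1 - (p i).1) = 0 := by
        refine le_antisymm hd1 ?_
        by_contra! h3
        nlinarith
      have h4 := hdiag i (by omega)
      rcases hσ with rfl | rfl
      · exact h4 (by linarith)
      · exact h4 (by linarith)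

lemma FR_low (hp : LPath τ p i0 i1) (h01 : i0 ≤ i1) {w : ℤ × ℤ} (hw : Odd w.1)
    (hlow : ∀ i, w.2 < (p i).2) : FR p i0 i1 w =
      (if (p i0).1 ≤ w.1 then 1 else 0) + (if (p i1).1 ≤ w.1 then 1 else 0) := by
  rw [← sum_telescope_zmod2 (fun i => if (p i).1 ≤ w.1 then (1 : ZMod 2) else 0) h01]
  refine Finset.sum_congr rfl fun i hi => ?_
  rw [Finset.mem_Ico] at hi
  obtain ⟨⟨⟨k1, h1⟩, -⟩, ⟨⟨k2, h2⟩, -⟩, h3, -⟩ := hp i hi.1 hi.2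
  obtain ⟨k3, h4⟩ := hw
  have h5 := hlow i
  have h6 := hlow (i + 1)
  unfold crossR
  split_ifs <;> first | decide | (exfalso; omega)

lemma FR_high {w : ℤ × ℤ} (hhigh : ∀ i, (p i).2 ≤ w.2) : FR p i0 i1 w = 0 := by
  refine Finset.sum_eq_zero fun i _ => if_neg fun h => ?_
  have h1 := hhigh i
  have h2 := hhigh (i + 1)
  omega

/-- The parity function separating the two sides of a crossing of the strip. -/
lemma Cross.exists_parity (hτ : τ = 1 ∨ τ = -1) (hσ : σ = 1 ∨ σ = -1)
    (hp : LPath τ p i0 i1) (hn : ∀ i, |(p i).2| ≤ n) (h : Cross p c r σ i0 i1 π) :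
    ∃ g : ℤ × ℤ → ZMod 2,
      (∀ C : Set (ℝ × ℝ), IsPreconnected C → (∀ x ∈ C, |x.1 - c| ≤ r) → Disjoint C π →
        ∀ w w', Typ (-τ) w → Typ (-τ) w' → ∀ x ∈ C, x ∈ face w → ∀ y ∈ C, y ∈ face w' →
          g w = g w') ∧
      (∀ w, n ≤ w.2 → g w = 0) ∧ (∀ w, Odd w.1 → w.2 < -n → g w = 1) ∧
      ∀ w, |(w.1 : ℝ) - c| < r → g w = FR p i0 i1 w := by
  have hlt := h.lt
  have ht0 : Typ τ (p i0) := (hp i0 le_rfl hlt).1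
  have ht1 : Typ τ (p i1) := by
    have := (hp (i1 - 1) (by omega) (by omega)).2.1
    rwa [Nat.sub_add_cancel (by omega)] at this
  have hn' : ∀ i, -n ≤ (p i).2 ∧ (p i).2 ≤ n := fun i => abs_le.1 (hn i)
  have hdis : ∀ C : Set (ℝ × ℝ), (∀ x ∈ C, |x.1 - c| ≤ r) → Disjoint C π →
      ∀ i, i0 ≤ i → i < i1 → Disjoint C (eseg (p i) (p (i + 1))) := by
    intro C hC hd i hi hi'
    rw [Set.disjoint_left] at hd ⊢
    exact fun x hx hxe => hd hx (h.inside i hi hi' x hxe (hC x hx))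
  have h1 := h.start
  have h2 := h.finish
  rcases hσ with rfl | rfl
  · have hR0 : ∀ x ∈ {x : ℝ × ℝ | |x.1 - c| ≤ r}, x.1 ≤ (p i0).1 := by
      intro x (hx : |x.1 - c| ≤ r)
      rw [abs_le] at hx
      linarith
    have hR1 : ∀ x ∈ {x : ℝ × ℝ | |x.1 - c| ≤ r}, ((p i1).1 : ℝ) ≤ x.1 := by
      intro x (hx : |x.1 - c| ≤ r)
      rw [abs_le] at hx
      linarith
    refine ⟨gpar p i0 i1 _ _, fun C hC hCR hCd w w' hw hw' x hx hxw y hy hyw =>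
      gpar_const hτ hlt hp (isCorr_right hτ ht0 hR0) (isCorr_left hτ ht1 hR1) hC hCR
        (hdis C hCR hCd) hw hw' hx hxw hy hyw, ?_, ?_, ?_⟩ <;> intro w
    · intro hw
      have e1 := (hn' i0).2
      have e2 := (hn' i1).2
      unfold gpar
      beta_reduce
      rw [FR_high fun i => (hn' i).2.trans hw, if_neg (by omega), if_neg (by omega)]
      rfl
    · intro hodd hw
      have e1 := (hn' i0).1
      have e2 := (hn' i1).1
      unfold gpar
      beta_reduce
      rw [FR_low hp hlt.le hodd fun i => by have := (hn' i).1; omega]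
      split_ifs <;> first | decide | (exfalso; omega)
    · intro hw
      rw [abs_lt] at hw
      have e1 : w.1 < (p i0).1 := by rify; linarith
      have e2 : (p i1).1 < w.1 := by rify; linarith
      unfold gpar
      beta_reduce
      rw [if_neg (by omega), if_neg (by omega), add_zero, add_zero]
  · have hR0 : ∀ x ∈ {x : ℝ × ℝ | |x.1 - c| ≤ r}, ((p i0).1 : ℝ) ≤ x.1 := by
      intro x (hx : |x.1 - c| ≤ r)
      rw [abs_le] at hx
      linarith
    have hR1 : ∀ x ∈ {x : ℝ × ℝ | |x.1 - c| ≤ r}, x.1 ≤ (p i1).1 := by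
      intro x (hx : |x.1 - c| ≤ r)
      rw [abs_le] at hx
      linarith
    refine ⟨gpar p i0 i1 _ _, fun C hC hCR hCd w w' hw hw' x hx hxw y hy hyw =>
      gpar_const hτ hlt hp (isCorr_left hτ ht0 hR0) (isCorr_right hτ ht1 hR1) hC hCR
        (hdis C hCR hCd) hw hw' hx hxw hy hyw, ?_, ?_, ?_⟩ <;> intro w
    · intro hw
      have e1 := (hn' i0).2
      have e2 := (hn' i1).2
      unfold gpar
      beta_reduce
      rw [FR_high fun i => (hn' i).2.trans hw, if_neg (by omega), if_neg (by omega)]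
      rfl
    · intro hodd hw
      have e1 := (hn' i0).1
      have e2 := (hn' i1).1
      unfold gpar
      beta_reduce
      rw [FR_low hp hlt.le hodd fun i => by have := (hn' i).1; omega]
      split_ifs <;> first | decide | (exfalso; omega)
    · intro hw
      rw [abs_lt] at hw
      have e1 : (p i0).1 < w.1 := by rify; linarith
      have e2 : w.1 < (p i1).1 := by rify; linarith
      unfold gpar
      beta_reduce
      rw [if_neg (by omega), if_neg (by omega), add_zero, add_zero]

/-- A connected set which avoids two crossings does not lead from a vertex with different
parities for them to the top or the bottom of the box. -/
lemma Cross.no_escape (hτ : τ = 1 ∨ τ = -1) {σ' : ℝ} (hσ : σ = 1 ∨ σ = -1)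
    (hσ' : σ' = 1 ∨ σ' = -1)
    {v : ℝ × ℝ} {r2 : ℝ} (hp : LPath τ p i0 i1) (hp' : LPath τ p j0 j1)
    (hn : ∀ i, |(p i).2| ≤ n) (h : Cross p v.1 r σ i0 i1 π) (h' : Cross p v.1 r σ' j0 j1 π')
    (hπ : π ∪ π' ⊆ boxR v r r2) {w : ℤ × ℤ} (hw : Typ (-τ) w) (hwc : |(w.1 : ℝ) - v.1| < r)
    (hne : FR p i0 i1 w ≠ FR p j0 j1 w) {C : Set (ℝ × ℝ)} (hC : IsPreconnected C)
    (hCB : C ⊆ boxR v r r2 \ (π ∪ π')) (hwC : toR w ∈ C) : Disjoint C (horEdges v r r2) := by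
  rw [Set.disjoint_left]
  rintro y hyC ⟨-, hy⟩
  obtain ⟨g, hg, hg1, hg2, hg3⟩ := h.exists_parity hτ hσ hp hn
  obtain ⟨g', hg', hg1', hg2', hg3'⟩ := h'.exists_parity hτ hσ' hp' hn
  rw [← hg3 w hwc, ← hg3' w hwc] at hne
  -- extend the set by a vertical ray
  have key : ∀ I : Set ℝ, IsPreconnected I → y.2 ∈ I →
      (∀ x ∈ I, |x - v.2| ≤ r2 → x = y.2) → ∀ Y ∈ I, ∃ w', Typ (-τ) w' ∧ |Y - w'.2| ≤ 2 ∧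
        g w = g w' ∧ g' w = g' w' := by
    intro I hI hyI hIr Y hY
    obtain ⟨w', hw', hf⟩ := exists_face (τ := -τ) (by omega) (y.1, Y)
    have hray : IsPreconnected ((fun t => (y.1, t)) '' I) := hI.image _ (by fun_prop)
    have hun : IsPreconnected (C ∪ (fun t => (y.1, t)) '' I) :=
      hC.union y hyC ⟨y.2, hyI, rfl⟩ hray
    have hstrip : ∀ x ∈ C ∪ (fun t => (y.1, t)) '' I, |x.1 - v.1| ≤ r := by
      rintro x (hx | ⟨t, -, rfl⟩)
      · exact (hCB hx).1.1
      · exact (hCB hyC).1.1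
    have hdis : Disjoint (C ∪ (fun t => (y.1, t)) '' I) (π ∪ π') := by
      rw [Set.disjoint_left]
      rintro x (hx | ⟨t, ht, rfl⟩) hxπ
      · exact (hCB hx).2 hxπ
      · have : t = y.2 := hIr t ht (hπ hxπ).2
        subst this
        exact (hCB hyC).2 hxπ
    have hYm : (y.1, Y) ∈ C ∪ (fun t => (y.1, t)) '' I := Or.inr ⟨Y, hY, rfl⟩
    refine ⟨w', hw', (face_bounds hf).2, ?_, ?_⟩
    · exact hg _ hun hstrip (hdis.mono_right Set.subset_union_left) w w' hw hw' _ (Or.inl hwC)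
        (toR_mem_face w) _ hYm hf
    · exact hg' _ hun hstrip (hdis.mono_right Set.subset_union_right) w w' hw hw' _ (Or.inl hwC)
        (toR_mem_face w) _ hYm hf
  have hr2 : 0 ≤ r2 := hy ▸ abs_nonneg _
  rcases (abs_eq hr2).1 hy with hy | hy
  · obtain ⟨w', hw', h1, h2, h3⟩ := key (Set.Ici y.2) isPreconnected_Ici Set.self_mem_Ici
      (fun x hx hxr => by
        rw [abs_le] at hxr
        rw [Set.mem_Ici] at hx
        linarith) (max y.2 (n + 2)) (Set.mem_Ici.2 (le_max_left _ _))
    have : n ≤ w'.2 := by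
      rw [abs_le] at h1
      rify
      linarith [le_max_right y.2 ((n : ℝ) + 2)]
    exact hne (h2.trans ((hg1 _ this).trans ((hg1' _ this).symm.trans h3.symm)))
  · obtain ⟨w', hw', h1, h2, h3⟩ := key (Set.Iic y.2) isPreconnected_Iic Set.self_mem_Iic
      (fun x hx hxr => by
        rw [abs_le] at hxr
        rw [Set.mem_Iic] at hx
        linarith) (min y.2 (-n - 3)) (Set.mem_Iic.2 (min_le_left _ _))
    have : w'.2 < -n := by
      rw [abs_le] at h1
      rify
      linarith [min_le_right y.2 (-(n : ℝ) - 3)]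
    exact hne (h2.trans ((hg2 _ hw'.1 this).trans ((hg2' _ hw'.1 this).symm.trans h3.symm)))

end Crossing

section Dual

variable {n : ℤ} {M : Set ((ℤ × ℤ) × (ℤ × ℤ))} {τ : ℤ} {p : ℕ → ℤ × ℤ} {T : ℕ}
  {c r σ : ℝ} {i0 i1 j0 j1 : ℕ} {π π' : Set (ℝ × ℝ)}

lemma Absorbed.lpath (h : Absorbed M n τ p T) (hi : i1 ≤ T) : LPath τ p i0 i1 :=
  fun i _ h1 => ⟨(h.stp i (by omega)).1, (h.stp i (by omega)).typ_right, (h.stp i (by omega)).diag⟩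

lemma Absorbed.bounds (hM : IsAztecMatching n M) (hn : (4 : ℤ) ∣ n) (h : Absorbed M n τ p T)
    (i : ℕ) : |(p i).1| ≤ n + 1 ∧ |(p i).2| ≤ n := by
  rcases lt_or_ge i T with hi | hi
  · have := (h.stp i hi).inBox_left hM
    exact ⟨this.1.trans (by omega), this.2⟩
  · rw [h.const i hi]
    have h0 := h.pos
    have := (h.stp (T - 1) (by omega)).bounds hM hn
    rwa [Nat.sub_add_cancel (by omega)] at this

lemma Cross.far (hσ : σ = 1 ∨ σ = -1) (h : Cross p c r σ i0 i1 π) :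
    r ≤ |((p i0).1 : ℝ) - c| ∧ r ≤ |((p i1).1 : ℝ) - c| := by
  have h1 := h.start
  have h2 := h.finish
  rcases hσ with rfl | rfl
  · exact ⟨by linarith [le_abs_self (((p i0).1 : ℝ) - c)],
      by linarith [neg_abs_le (((p i1).1 : ℝ) - c)]⟩
  · exact ⟨by linarith [neg_abs_le (((p i0).1 : ℝ) - c)],
      by linarith [le_abs_self (((p i1).1 : ℝ) - c)]⟩

set_option maxHeartbeats 800000 in
/-- Just below the topmost edge of two successive crossings over the middle of the strip there is a
dual vertex with different parities for them. -/
lemma Cross.exists_dual (hM : IsAztecMatching n M) (hn : (4 : ℤ) ∣ n) (hτ : τ = 1 ∨ τ = -1)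
    (hA : Absorbed M n τ p T) {σ' : ℝ} (hσ : σ = 1 ∨ σ = -1) (hσ' : σ' = 1 ∨ σ' = -1)
    (hr : 3 < r) (h : Cross p c r σ i0 i1 π) (h' : Cross p c r σ' j0 j1 π')
    (hi : i1 ≤ T) (hj : j1 ≤ T) (hij : i1 ≤ j0 + 1) :
    ∃ m w, Typ (-τ) w ∧ FR p i0 i1 w ≠ FR p j0 j1 w ∧ m < T ∧
      (i0 ≤ m ∧ m < i1 ∨ j0 ≤ m ∧ m < j1) ∧
      |((p m).1 : ℝ) - c| ≤ 3 ∧ |((p (m + 1)).1 : ℝ) - c| ≤ 3 ∧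
      (w.1 = (p m).1 ∨ w.1 = (p (m + 1)).1) ∧ (w.2 = (p m).2 ∨ w.2 = (p (m + 1)).2) := by
  obtain ⟨x, hx, hx1, hx2⟩ : ∃ x : ℤ, Odd x ∧ c - 1 ≤ x ∧ x ≤ c + 1 := by
    refine ⟨2 * ⌊c / 2⌋ + 1, ⟨_, rfl⟩, ?_, ?_⟩ <;> push_cast <;>
      linarith [Int.floor_le (c / 2), Int.lt_floor_add_one (c / 2)]
  have hfar : ∀ i, r ≤ |((p i).1 : ℝ) - c| → (p i).1 < x ∨ x + 2 < (p i).1 := by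
    intro i hi
    rcases le_abs.1 hi with hi | hi
    · right; rify; linarith
    · left; rify; linarith
  have hb : ∀ i, -n ≤ (p i).2 := fun i => (abs_le.1 (hA.bounds hM hn i).2).1
  let S : Finset ℕ := (Finset.range T).filter fun m =>
    (i0 ≤ m ∧ m < i1 ∨ j0 ≤ m ∧ m < j1) ∧ (p m).1 + (p (m + 1)).1 = 2 * x + 2
  have hS : ∀ m, m ∈ S ↔ m < T ∧ (i0 ≤ m ∧ m < i1 ∨ j0 ≤ m ∧ m < j1) ∧
      (p m).1 + (p (m + 1)).1 = 2 * x + 2 := by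
    intro m
    simp only [S, Finset.mem_filter, Finset.mem_range]
  have hne : S.Nonempty := by
    have e := FR_low (hA.lpath hi) h.lt.le (w := (x, -n - 1)) hx
      (fun i => by have := hb i; dsimp only; omega)
    have e0 := hfar _ (h.far hσ).1
    have e1 := hfar _ (h.far hσ).2
    have e2 := h.start
    have e3 := h.finish
    have e4 : FR p i0 i1 (x, -n - 1) = 1 := by
      rw [e]
      have : ((p i0).1 ≤ x ∧ ¬ (p i1).1 ≤ x) ∨ (¬ (p i0).1 ≤ x ∧ (p i1).1 ≤ x) := by
        rcases hσ with rfl | rfl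
        · right
          rify
          constructor <;> linarith
        · left
          rify
          constructor <;> linarith
      rcases this with ⟨h1, h2⟩ | ⟨h1, h2⟩
      · rw [if_pos h1, if_neg h2, add_zero]
      · rw [if_neg h1, if_pos h2, zero_add]
    have : ∃ i ∈ Finset.Ico i0 i1, crossR (p i) (p (i + 1)) (x, -n - 1) ≠ 0 := by
      by_contra! hcon
      rw [FR, Finset.sum_eq_zero hcon] at e4
      exact absurd e4 (by decide)
    obtain ⟨i, hi', hne⟩ := this
    rw [Finset.mem_Ico] at hi'
    unfold crossR at hne
    split_ifs at hne with hh
    · exact ⟨i, (hS i).2 ⟨by omega, Or.inl hi', hh.1⟩⟩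
    · simp at hne
  obtain ⟨m, hm, hmax⟩ := Finset.exists_max_image S (fun i => (p i).2 + (p (i + 1)).2) hne
  rw [hS] at hm
  obtain ⟨hmT, hmI, hmx⟩ := hm
  have hstp := hA.stp m hmT
  obtain ⟨wu, wd, hwu, hwd, hd, hm1, hm2, hu, hd1, hd2⟩ := exists_dual_pair hτ hstp.1 hstp.diag
  have hdg := hstp.diag
  unfold Diag at hdg hd
  have hpm : ((p m).1 = x ∨ (p m).1 = x + 2) ∧ ((p (m + 1)).1 = x ∨ (p (m + 1)).1 = x + 2) := by
    omega
  have hnear : ∀ y : ℤ, y = x ∨ y = x + 2 → |(y : ℝ) - c| ≤ 3 := by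
    rintro y (rfl | rfl) <;> rw [abs_le] <;> push_cast <;> constructor <;> linarith
  have key : ∀ a0 a1 : ℕ, a0 ≤ a1 → a1 ≤ T → r ≤ |((p a0).1 : ℝ) - c| → r ≤ |((p a1).1 : ℝ) - c| →
      (∀ i, a0 ≤ i → i < a1 → i0 ≤ i ∧ i < i1 ∨ j0 ≤ i ∧ i < j1) →
      FR p a0 a1 wd = if a0 ≤ m ∧ m < a1 then 1 else 0 := by
    intro a0 a1 h01 ha hf0 hf1 hsub
    have g0 := hfar _ hf0
    have g1 := hfar _ hf1
    have hl : LPath τ p a0 a1 := hA.lpath ha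
    have hab : ∀ w : ℤ × ℤ, w.1 = x ∨ w.1 = x + 2 → above (p a0) w = 0 ∧ above (p a1) w = 0 := by
      intro w hw
      constructor <;> exact if_neg (by omega)
    have hu0 : FR p a0 a1 wu = 0 := by
      have hS' : ∀ i, a0 ≤ i → i < a1 → (p i).1 + (p (i + 1)).1 = 2 * x + 2 →
          (p i).2 + (p (i + 1)).2 ≤ (p m).2 + (p (m + 1)).2 := fun i h1 h2 h3 =>
        hmax i ((hS i).2 ⟨by omega, hsub i h1 h2, h3⟩)
      rcases (by omega : wu.1 = x ∨ wu.1 = x + 2) with hw | hw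
      · refine Finset.sum_eq_zero fun i hi => if_neg fun hh => ?_
        rw [Finset.mem_Ico] at hi
        have := hS' i hi.1 hi.2 (by omega)
        omega
      · have e1 := FR_add_FL hτ h01 hl hwu
        have e2 : FL p a0 a1 wu = 0 := by
          refine Finset.sum_eq_zero fun i hi => if_neg fun hh => ?_
          rw [Finset.mem_Ico] at hi
          have := hS' i hi.1 hi.2 (by omega)
          omega
        rwa [(hab wu (Or.inr hw)).1, (hab wu (Or.inr hw)).2, e2, add_zero, add_zero] at e1
    have e3 : FR p a0 a1 wd = FH p a0 a1 wd wu := by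
      rcases hd.1 with hw | hw
      · have := FR_adj hτ h01 hl hwd hwu hw (by omega)
        rwa [(hab wu (by omega)).1, (hab wu (by omega)).2, hu0, add_zero, add_zero, add_zero] at this
      · have := FR_adj hτ h01 hl hwu hwd (by omega) (by omega)
        rwa [(hab wd (by omega)).1, (hab wd (by omega)).2, hu0, add_zero, add_zero, zero_add,
          FH_comm] at this
    rw [e3]
    split_ifs with hm
    · exact FH_eq_one hM (fun i _ h2 => hA.stp i (by omega))
        (fun i j _ h2 _ h4 he => hA.inj hM (by omega) (by omega) he) hm.1 hm.2 hm1 hm2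
    · refine Finset.sum_eq_zero fun i hi => if_neg fun hh => hm ?_
      rw [Finset.mem_Ico] at hi
      have := (hA.stp i (by omega)).midpoint_inj hM hstp (by omega) (by omega)
      rwa [← hA.inj hM (by omega) hmT this]
  have k1 := key i0 i1 h.lt.le hi (h.far hσ).1 (h.far hσ).2 fun i h1 h2 => Or.inl ⟨h1, h2⟩
  have k2 := key j0 j1 h'.lt.le hj (h'.far hσ').1 (h'.far hσ').2 fun i h1 h2 => Or.inr ⟨h1, h2⟩
  refine ⟨m, wd, hwd, ?_, hmT, hmI, hnear _ hpm.1, hnear _ hpm.2, hd1, hd2⟩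
  have hnot : ¬ ((i0 ≤ m ∧ m < i1) ∧ j0 ≤ m ∧ m < j1) := by
    rintro ⟨h1, h2⟩
    have : m + 1 = i1 := by omega
    have g := hfar _ (h.far hσ).2
    rw [← this] at g
    omega
  rw [k1, k2]
  rcases hmI with h1 | h1
  · rw [if_pos h1, if_neg fun h2 => hnot ⟨h1, h2⟩]
    decide
  · rw [if_pos h1, if_neg fun h2 => hnot ⟨h2, h1⟩]
    decide

end Dual

lemma convex_boxR (v : ℝ × ℝ) (r1 r2 : ℝ) : Convex ℝ (boxR v r1 r2) := by
  have : boxR v r1 r2 =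
      Set.Icc (v.1 - r1) (v.1 + r1) ×ˢ Set.Icc (v.2 - r2) (v.2 + r2) := by
    ext x
    simp only [boxR, Set.mem_ofPred_eq, Set.mem_prod, Set.mem_Icc, abs_le]
    constructor <;> rintro ⟨⟨h1, h2⟩, h3, h4⟩ <;> refine ⟨⟨?_, ?_⟩, ?_, ?_⟩ <;> linarith
  rw [this]
  exact (convex_Icc _ _).prod (convex_Icc _ _)

/-- A segment leaving the horizontal strip through its boundary first meets the boundary. -/
lemma exists_exit {v : ℝ × ℝ} {r1 r2 : ℝ} {x y : ℝ × ℝ} (hx : x ∈ boxR v r1 r2)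
    (hy : |y.1 - v.1| ≤ r1) (hy2 : r2 < |y.2 - v.2|) :
    ∃ y' ∈ segment ℝ x y, y' ∈ horEdges v r1 r2 ∧ segment ℝ x y' ⊆ boxR v r1 r2 := by
  have hcont : ContinuousOn (fun q : ℝ × ℝ => |q.2 - v.2|) (segment ℝ x y) := by fun_prop
  obtain ⟨y', hy', he⟩ := (convex_segment x y).isPreconnected.intermediate_value
    (left_mem_segment ℝ x y) (right_mem_segment ℝ x y) hcont ⟨hx.2, hy2.le⟩
  have hs : |y'.1 - v.1| ≤ r1 := by
    have h1 : Convex ℝ {q : ℝ × ℝ | |q.1 - v.1| ≤ r1} := by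
      have : {q : ℝ × ℝ | |q.1 - v.1| ≤ r1} = Set.Icc (v.1 - r1) (v.1 + r1) ×ˢ Set.univ := by
        ext q
        simp only [Set.mem_ofPred_eq, Set.mem_prod, Set.mem_Icc, abs_le, Set.mem_univ, and_true]
        constructor <;> rintro ⟨h1, h2⟩ <;> constructor <;> linarith
      rw [this]
      exact (convex_Icc _ _).prod convex_univ
    exact h1.segment_subset hx.1 hy hy'
  have hB : y' ∈ boxR v r1 r2 := ⟨hs, le_of_eq he⟩
  exact ⟨y', hy', ⟨hB, he⟩, (convex_boxR v r1 r2).segment_subset hx hB⟩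

section Walk

variable {n : ℤ} {M : Set ((ℤ × ℤ) × (ℤ × ℤ))} {τ : ℤ}

/-- Forest paths run until the backbone make horizontal displacements at most `D` as long as their
vertical displacement is at most `2 r₂`. -/
def Narrow (M : Set ((ℤ × ℤ) × (ℤ × ℤ))) (n τ : ℤ) (r2 D : ℝ) : Prop :=
  ∀ w z, Typ τ w → inBox n w →
    Relation.ReflTransGen (fun x y => Stp M n τ x y ∧ x ∉ BB M n τ) w z →
    |z.2| ≤ n → |(z.2 : ℝ) - w.2| ≤ 2 * r2 → |(z.1 : ℝ) - w.1| ≤ D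

/-- A forest path started inside a region of the box which does not reach the horizontal edges hits
the backbone inside that region. -/
lemma exists_walk (hM : IsAztecMatching n M) (hn : (4 : ℤ) ∣ n) (h0 : 0 ≤ n)
    (hτ : τ = 1 ∨ τ = -1) {v : ℝ × ℝ} {r1 r2 D : ℝ} {π : Set (ℝ × ℝ)} (hD : 0 ≤ D)
    (hpar : Narrow M n τ r2 D) (hbox : ∀ x : ℝ, |x - v.1| ≤ r1 → |x| ≤ n + 1) {w : ℤ × ℤ}
    (hw : Typ τ w) (hwn : |w.2| ≤ n) (hwB : |(w.2 : ℝ) - v.2| ≤ r2)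
    (hwD : |(w.1 : ℝ) - v.1| + D ≤ r1 - 3)
    (hK : ∀ C, IsPreconnected C → C ⊆ bigBox n → toR w ∈ C →
      (∀ a b, Stp M n (-τ) a b → Disjoint C (eseg a b)) → Disjoint C π)
    (hsafe : ∀ C, IsPreconnected C → C ⊆ boxR v r1 r2 \ π → toR w ∈ C →
      Disjoint C (horEdges v r1 r2)) :
    ∃ z ∈ BB M n τ, ∃ W, IsPreconnected W ∧ W ⊆ bigBox n ∧ W ⊆ boxR v r1 r2 ∧ toR w ∈ W ∧
      toR z ∈ W ∧ (∀ a b, Stp M n (-τ) a b → Disjoint W (eseg a b)) ∧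
      |(z.1 : ℝ) - w.1| ≤ D := by
  have hbox' : ∀ x : ℤ, |(x : ℝ) - v.1| ≤ r1 - 1 → |x| ≤ n := by
    intro x hx
    rw [abs_le] at hx
    have h1 := hbox (x + 1) (by rw [abs_le]; constructor <;> linarith)
    have h2 := hbox (x - 1) (by rw [abs_le]; constructor <;> linarith)
    rw [abs_le] at h1 h2 ⊢
    constructor <;> rify <;> linarith
  have hwin : inBox n w := ⟨hbox' w.1 (by linarith), hwn⟩
  let Inv : ℤ × ℤ → Prop := fun z =>
    Relation.ReflTransGen (fun x y => Stp M n τ x y ∧ x ∉ BB M n τ) w z ∧ Typ τ z ∧ |z.2| ≤ n ∧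
      ∃ W, IsPreconnected W ∧ W ⊆ bigBox n ∧ W ⊆ boxR v r1 r2 ∧ toR w ∈ W ∧
        toR z ∈ W ∧ (∀ a b, Stp M n (-τ) a b → Disjoint W (eseg a b))
  have hInvD : ∀ z, Inv z → |(z.1 : ℝ) - w.1| ≤ D := by
    rintro z ⟨h1, -, h3, W, -, -, hWB, -, hzW, -⟩
    refine hpar w z hw hwin h1 h3 ?_
    have : |(z.2 : ℝ) - v.2| ≤ r2 := (hWB hzW).2
    rw [abs_le] at this hwB ⊢
    constructor <;> linarith
  by_contra hcon
  have hBB : ∀ z, Inv z → z ∉ BB M n τ := fun z hz hzB => by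
    obtain ⟨-, -, -, W, h⟩ := id hz
    exact hcon ⟨z, hzB, W, h.1, h.2.1, h.2.2.1, h.2.2.2.1, h.2.2.2.2.1, h.2.2.2.2.2, hInvD z hz⟩
  have hstep : ∀ z, Inv z → ∃ z', Stp M n τ z z' ∧ Inv z' := by
    intro z hz
    have hzD := hInvD z hz
    have hzB := hBB z hz
    obtain ⟨h1, h2, h3, W, hWc, hWb, hWB, hwW, hzW, hWd⟩ := hz
    have hz1 : |(z.1 : ℝ) - v.1| ≤ r1 - 3 := by
      have := abs_sub_le (z.1 : ℝ) w.1 v.1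
      linarith
    obtain ⟨z', hs⟩ := exists_stp hM h2 ⟨hbox' _ (by linarith), h3⟩
    have hzb := hWB hzW
    have hz'1 : |(z'.1 : ℝ) - v.1| ≤ r1 := by
      have hd : |(z'.1 : ℝ) - z.1| ≤ 2 := by
        have := hs.diag.1
        rw [abs_le]
        rcases this with h | h <;> rw [h] <;> push_cast <;> constructor <;> linarith
      have := abs_sub_le (z'.1 : ℝ) z.1 v.1
      linarith
    have hed : ∀ a b, Stp M n (-τ) a b → Disjoint (eseg z z') (eseg a b) :=
      fun a b hab => hs.disjoint_eseg hM hτ hab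
    have heb := hs.eseg_subset hM hn
    refine ⟨z', hs, h1.tail ⟨hs, hzB⟩, hs.typ_right, (hs.bounds hM hn).2, W ∪ eseg z z',
      hWc.union _ hzW (left_mem_eseg _ _) (isPreconnected_eseg _ _), Set.union_subset hWb heb,
      Set.union_subset hWB ?_, Or.inl hwW, Or.inr (right_mem_eseg _ _),
      fun a b hab => (hWd a b hab).union_left (hed a b hab)⟩
    by_cases hz'2 : |(z'.2 : ℝ) - v.2| ≤ r2
    · exact (convex_boxR v r1 r2).segment_subset hzb ⟨hz'1, hz'2⟩
    · exfalso
      push Not at hz'2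
      obtain ⟨y, hy, hyh, hys⟩ := exists_exit (y := toR z') hzb hz'1 hz'2
      have hsub : segment ℝ (toR z) y ⊆ eseg z z' :=
        (convex_segment _ _).segment_subset (left_mem_segment _ _ _) hy
      have hCc : IsPreconnected (W ∪ segment ℝ (toR z) y) :=
        hWc.union _ hzW (left_mem_segment _ _ _) (convex_segment _ _).isPreconnected
      have hCπ := hK _ hCc (Set.union_subset hWb (hsub.trans heb)) (Or.inl hwW)
        fun a b hab => (hWd a b hab).union_left ((hed a b hab).mono_left hsub)
      have := hsafe _ hCc (fun x hx => ⟨(Set.union_subset hWB hys) hx,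
        Set.disjoint_left.1 hCπ hx⟩) (Or.inl hwW)
      exact Set.disjoint_left.1 this (Or.inr (right_mem_segment _ _ _)) hyh
  have hInv0 : Inv w := by
    refine ⟨.refl, hw, hwn, {toR w}, isPreconnected_singleton, ?_, ?_, rfl, rfl, ?_⟩
    · rw [Set.singleton_subset_iff]
      have h1 := hwin.1
      constructor
      · simp only [toR]
        exact_mod_cast h1.trans (by omega)
      · simp only [toR]
        exact_mod_cast hwn
    · rw [Set.singleton_subset_iff]
      exact ⟨by simp only [toR]; linarith, hwB⟩
    · intro a b hab
      rw [Set.disjoint_singleton_left]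
      exact hab.toR_notMem_eseg (by omega) (by rwa [neg_neg])
  choose f hf hfI using hstep
  let b : ℕ → {z // Inv z} := fun i => (fun z : {z // Inv z} => ⟨f z.1 z.2, hfI z.1 z.2⟩)^[i] ⟨w, hInv0⟩
  have hb : ∀ i, Stp M n τ (b i).1 (b (i + 1)).1 := by
    intro i
    have : b (i + 1) = ⟨f (b i).1 (b i).2, hfI (b i).1 (b i).2⟩ :=
      Function.iterate_succ_apply' _ i _
    rw [this]
    exact hf _ _
  refine no_infinite_walk hM hn (2 * n).toNat τ hτ (fun i => (b i).1) hb fun i => ?_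
  have := (abs_le.1 (b i).2.2.2.1).2
  omega

end Walk

lemma curve_nonempty (p : ℕ → ℤ × ℤ) : (curve p).Nonempty := ⟨_, toR_mem_curve p 0⟩

section Sides

variable {n : ℤ} {M : Set ((ℤ × ℤ) × (ℤ × ℤ))} {τ : ℤ} {p : ℕ → ℤ × ℤ} {T : ℕ}

/-- A connected set avoiding a path from a source is separated by the path from one of the two dual
vertices across an edge of the path. -/
lemma Absorbed.one_side (hM : IsAztecMatching n M) (hn : (4 : ℤ) ∣ n) (hτ : τ = 1 ∨ τ = -1)
    (h : Absorbed M n τ p T) (hsrc : Src n τ (p 0)) {i : ℕ} (hi : i < T) {K : Set (ℝ × ℝ)}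
    (hK : IsPreconnected K) (hKb : K ⊆ bigBox n) (hKd : Disjoint (curve p) K) :
    ∃ w, Axis (p i) w ∧ (w.2 = (p i).2 ∨ w.2 = (p (i + 1)).2) ∧
      (w.1 = (p i).1 ∨ w.1 = (p (i + 1)).1) ∧
      ∀ C, IsPreconnected C → C ⊆ bigBox n → toR w ∈ C → Disjoint C (curve p) → Disjoint C K := by
  have hs := h.stp i hi
  have hdg := hs.diag
  have hx1 : Axis (p i) ((p (i + 1)).1, (p i).2) := Or.inr ⟨rfl, hdg.1⟩
  have hx2 : Axis (p i) ((p i).1, (p (i + 1)).2) := Or.inl ⟨rfl, hdg.2⟩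
  by_contra! hcon
  obtain ⟨C1, hC1, hC1b, hw1, hC1d, hC1K⟩ := hcon _ hx1 (Or.inl rfl) (Or.inr rfl)
  obtain ⟨C2, hC2, hC2b, hw2, hC2d, hC2K⟩ := hcon _ hx2 (Or.inr rfl) (Or.inl rfl)
  rw [Set.not_disjoint_iff] at hC1K hC2K
  obtain ⟨x1, hx1C, hx1K⟩ := hC1K
  obtain ⟨x2, hx2C, hx2K⟩ := hC2K
  have hC : IsPreconnected (C1 ∪ (K ∪ C2)) :=
    hC1.union _ hx1C (Or.inl hx1K) (hK.union _ hx2K hx2C hC2)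
  have hCd : Disjoint (C1 ∪ (K ∪ C2)) (curve p) := hC1d.union_left (hKd.symm.union_left hC2d)
  obtain ⟨c0, hc0⟩ : ∃ c0, IsCorr τ (bigBox n) (p 0) c0 := by
    obtain ⟨h1, -, h2⟩ := hsrc
    have hR : ∀ x ∈ bigBox n, -(n : ℝ) ≤ x.2 ∧ x.2 ≤ n := fun x hx => abs_le.1 hx.2
    rcases (abs_eq (h2 ▸ abs_nonneg _)).1 h2 with h2 | h2
    · exact ⟨_, isCorr_top hτ h1 fun x hx => by rw [h2]; exact (hR x hx).2⟩
    · exact ⟨_, isCorr_bot hτ h1 fun x hx => by rw [h2]; push_cast; exact (hR x hx).1⟩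
  have hT : Typ τ (p T) := by
    have h0 := h.pos
    have := (h.stp (T - 1) (by omega)).typ_right
    rwa [Nat.sub_add_cancel (by omega)] at this
  obtain ⟨c1, hc1⟩ : ∃ c1, IsCorr τ (bigBox n) (p T) c1 := by
    have h1 := h.out
    have h2 := (h.bounds hM hn T).1
    have hR : ∀ x ∈ bigBox n, -((n : ℝ) + 1) ≤ x.1 ∧ x.1 ≤ n + 1 := fun x hx => abs_le.1 hx.1
    rw [abs_le] at h1 h2
    rcases (by omega : (p T).1 = n + 1 ∨ (p T).1 = -(n + 1)) with h3 | h3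
    · exact ⟨_, isCorr_right hτ hT fun x hx => by rw [h3]; push_cast; exact (hR x hx).2⟩
    · exact ⟨_, isCorr_left hτ hT fun x hx => by rw [h3]; push_cast; exact (hR x hx).1⟩
  have ht1 := hx1.typ hτ hs.1
  have ht2 := hx2.typ hτ hs.1
  have e1 := gpar_const hτ h.pos (h.lpath le_rfl) hc0 hc1 hC
    (Set.union_subset hC1b (Set.union_subset hKb hC2b))
    (fun j _ _ => hCd.mono_right (Set.subset_iUnion (fun j => eseg (p j) (p (j + 1))) j))
    ht1 ht2 (Or.inl hw1) (toR_mem_face _) (Or.inr (Or.inr hw2)) (toR_mem_face _)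
  have hmid : ∀ q : ℤ × ℤ, Typ τ q →
      ((((p i).1 + (p (i + 1)).1) / 2, ((p i).2 + (p (i + 1)).2) / 2) : ℝ × ℝ) ≠ toR q := by
    intro q hq he
    have e := congrArg Prod.fst he
    simp only [toR] at e
    have : (p i).1 + (p (i + 1)).1 = 2 * q.1 := by rify; linarith
    obtain ⟨k1, h1⟩ := hs.1.1
    obtain ⟨k2, h2⟩ := hq.1
    have := hdg.1
    omega
  have hmb : ((((p i).1 + (p (i + 1)).1) / 2, ((p i).2 + (p (i + 1)).2) / 2) : ℝ × ℝ) ∈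
      bigBox n := by
    refine hs.eseg_subset hM hn ?_
    have := midpoint_mem_segment (𝕜 := ℝ) (toR (p i)) (toR (p (i + 1)))
    rw [midpoint_eq_smul_add] at this
    unfold eseg
    convert this using 1
    simp only [toR, Prod.mk_add_mk, Prod.smul_mk, smul_eq_mul, Prod.mk.injEq, invOf_eq_inv]
    constructor <;> ring
  have hface : ∀ w : ℤ × ℤ, |(p i).1 + (p (i + 1)).1 - 2 * w.1| = 2 →
      |(p i).2 + (p (i + 1)).2 - 2 * w.2| = 2 →
      ((((p i).1 + (p (i + 1)).1) / 2, ((p i).2 + (p (i + 1)).2) / 2) : ℝ × ℝ) ∈ face w := by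
    intro w h1 h2
    have h1' : |((p i).1 : ℝ) + (p (i + 1)).1 - 2 * w.1| = 2 := by exact_mod_cast h1
    have h2' : |((p i).2 : ℝ) + (p (i + 1)).2 - 2 * w.2| = 2 := by exact_mod_cast h2
    have e1 : ((p i).1 + (p (i + 1)).1 : ℝ) / 2 - w.1 = ((p i).1 + (p (i + 1)).1 - 2 * w.1) / 2 := by
      ring
    have e2 : ((p i).2 + (p (i + 1)).2 : ℝ) / 2 - w.2 = ((p i).2 + (p (i + 1)).2 - 2 * w.2) / 2 := by
      ring
    change |((p i).1 + (p (i + 1)).1 : ℝ) / 2 - w.1| + |((p i).2 + (p (i + 1)).2 : ℝ) / 2 - w.2| ≤ 2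
    rw [e1, e2, abs_div, abs_div, h1', h2']
    norm_num
  have hd2 : ∀ a b : ℤ, b = a + 2 ∨ b = a - 2 → |a + b - 2 * b| = 2 ∧ |a + b - 2 * a| = 2 := by
    rintro a b (rfl | rfl) <;> constructor <;> ring_nf <;> norm_num
  have hdd : Diag ((p (i + 1)).1, (p i).2) ((p i).1, (p (i + 1)).2) := by
    unfold Diag at hdg ⊢
    dsimp only
    omega
  have e2 := gpar_adj hτ h.pos.le (h.lpath le_rfl) hc0 hc1 ht1 ht2 hdd hmb
    (hface _ (hd2 _ _ hdg.1).1 (hd2 _ _ hdg.2).2) (hface _ (hd2 _ _ hdg.1).2 (hd2 _ _ hdg.2).1)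
    (hmid _ hsrc.1) (hmid _ hT)
  rw [FH_eq_one hM (fun j _ h2 => h.stp j h2) (fun a b _ h2 _ h4 he => h.inj hM h2 h4 he)
    (Nat.zero_le i) hi (by dsimp only; ring) (by dsimp only), e1, zmod2_self] at e2
  exact absurd e2 (by decide)

end Sides

/-- The standing assumptions for the exploration of the region below the vertex `w0` between the
two crossings, whose union is `π`. -/
structure Setup (M : Set ((ℤ × ℤ) × (ℤ × ℤ))) (n : ℤ) (Γ : ℤ × ℤ → ℕ → ℤ × ℤ) (v : ℝ × ℝ)
    (r1 r2 D : ℝ) (π : Set (ℝ × ℝ)) (w0 : ℤ × ℤ) : Prop where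
  matching : IsAztecMatching n M
  four_dvd : (4 : ℤ) ∣ n
  nonneg : 0 ≤ n
  pth : ∀ τ : ℤ, τ = 1 ∨ τ = -1 → ∀ u, Src n τ u → IsPth M n τ u (Γ u)
  disp_nonneg : 0 ≤ D
  narrow : ∀ τ : ℤ, τ = 1 ∨ τ = -1 → Narrow M n τ r2 D
  width : ∀ x : ℝ, |x - v.1| ≤ r1 → |x| ≤ n + 1
  safe : ∀ C, IsPreconnected C → C ⊆ boxR v r1 r2 \ π → toR w0 ∈ C →
    Disjoint C (horEdges v r1 r2)

/-- The backbone path from `u` avoids `K` and reaches the region at its `i`th vertex; no path of the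
other sublattice that avoids `K` can meet the larger connected set `K'`. -/
structure Tip (n : ℤ) (Γ : ℤ × ℤ → ℕ → ℤ × ℤ) (v : ℝ × ℝ) (r1 r2 : ℝ) (π : Set (ℝ × ℝ))
    (w0 : ℤ × ℤ) (d : ℝ) (K K' : Set (ℝ × ℝ)) (τ : ℤ) (u : ℤ × ℤ) (i : ℕ) : Prop where
  src : Src n τ u
  disj : Disjoint (curve (Γ u)) K
  conn : ∃ C, IsPreconnected C ∧ C ⊆ boxR v r1 r2 \ π ∧ toR w0 ∈ C ∧ toR (Γ u i) ∈ C
  near : |((Γ u i).1 : ℝ) - v.1| ≤ d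
  pre : IsPreconnected K'
  sub : K' ⊆ bigBox n
  le : K ⊆ K'
  mem : curve (Γ u) ⊆ K'
  sep : ∀ u', Src n (-τ) u' → Disjoint (curve (Γ u')) K → Disjoint (curve (Γ u')) K'

section Exploration

variable {n : ℤ} {M : Set ((ℤ × ℤ) × (ℤ × ℤ))} {Γ : ℤ × ℤ → ℕ → ℤ × ℤ} {v : ℝ × ℝ}
  {r1 r2 D : ℝ} {π : Set (ℝ × ℝ)} {w0 : ℤ × ℤ} {τ : ℤ}

lemma Setup.absorbed (S : Setup M n Γ v r1 r2 D π w0) (hτ : τ = 1 ∨ τ = -1) {u : ℤ × ℤ}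
    (hu : Src n τ u) : ∃ T, Absorbed M n τ (Γ u) T :=
  (S.pth τ hτ u hu).exists_absorbed S.matching S.four_dvd S.nonneg hτ hu

/-- A new path of the other sublattice, found by a walk from a vertex `w` next to the path `u`. -/
lemma Setup.exists_tip (S : Setup M n Γ v r1 r2 D π w0) (hτ : τ = 1 ∨ τ = -1) {d : ℝ}
    {K K' : Set (ℝ × ℝ)} {u w : ℤ × ℤ} {i : ℕ} (hu : Src n τ u) (hKp : IsPreconnected K')
    (hKs : K' ⊆ bigBox n) (hmem : curve (Γ u) ⊆ K')
    (hsep : ∀ u', Src n (-τ) u' → Disjoint (curve (Γ u')) K → Disjoint (curve (Γ u')) K')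
    (hw : Axis (Γ u i) w) (hwn : |w.2| ≤ n) (hwd : |(w.1 : ℝ) - v.1| ≤ d) (hd : d + D ≤ r1 - 3)
    (hK : ∀ C, IsPreconnected C → C ⊆ bigBox n → toR w ∈ C →
      (∀ a b, Stp M n τ a b → Disjoint C (eseg a b)) → Disjoint C (K ∪ π))
    {C0 : Set (ℝ × ℝ)} (hC0 : IsPreconnected C0) (hC0s : C0 ⊆ boxR v r1 r2 \ π)
    (hw0C : toR w0 ∈ C0) (hwC : toR w ∈ C0) :
    ∃ u' j K'', Tip n Γ v r1 r2 π w0 (d + D) K' K'' (-τ) u' j := by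
  have hM := S.matching
  have hn := S.four_dvd
  obtain ⟨T, hT⟩ := S.absorbed hτ hu
  have hτ' : -τ = 1 ∨ -τ = -1 := by omega
  have hz : Typ τ (Γ u i) := by
    rcases lt_or_ge i T with hi | hi
    · exact (hT.stp i hi).1
    · have h0 := hT.pos
      have := (hT.stp (T - 1) (by omega)).typ_right
      rw [Nat.sub_add_cancel (by omega)] at this
      rwa [hT.const i hi]
  have hwt := hw.typ hτ hz
  have hedge : ∀ {τ' : ℤ} {p : ℕ → ℤ × ℤ} {T' : ℕ} {C : Set (ℝ × ℝ)}, Absorbed M n τ' p T' →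
      (∀ a b, Stp M n τ' a b → Disjoint C (eseg a b)) → Disjoint C (curve p) := by
    intro τ' p T' C hp hC
    rw [Set.disjoint_left]
    intro x hx hxc
    obtain ⟨k, hk, hxk⟩ := hp.mem_curve hxc
    exact Set.disjoint_left.1 (hC _ _ (hp.stp k hk)) hx hxk
  have hK' : ∀ C, IsPreconnected C → C ⊆ bigBox n → toR w ∈ C →
      (∀ a b, Stp M n (- -τ) a b → Disjoint C (eseg a b)) → Disjoint C (K ∪ π) := by
    intro C h1 h2 h3 h4
    rw [neg_neg] at h4
    exact hK C h1 h2 h3 h4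
  obtain ⟨z, hzB, W, hWc, hWb, hWB, hwW, hzW, hWd, hzD⟩ := exists_walk hM hn S.nonneg hτ'
    S.disp_nonneg (S.narrow _ hτ') S.width hwt hwn (hC0s hwC).1.2 (by linarith)
    (fun C h1 h2 h3 h4 => (hK' C h1 h2 h3 h4).mono_right Set.subset_union_right)
    (fun C h1 h2 h3 => (S.safe (C0 ∪ C) (hC0.union _ hwC h3 h1) (Set.union_subset hC0s h2)
      (Or.inl hw0C)).mono_left Set.subset_union_right)
  obtain ⟨u', j, hu', rfl⟩ := BB.exists_path hM (S.pth _ hτ') hzB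
  obtain ⟨T', hT'⟩ := S.absorbed hτ' hu'
  rw [neg_neg] at hWd
  have hWK := hK W hWc hWb hwW hWd
  have hdisj : Disjoint (curve (Γ u')) K := by
    have h1 : IsPreconnected (W ∪ curve (Γ u')) :=
      hWc.union _ hzW (toR_mem_curve _ j) (isPreconnected_curve _)
    have := hK _ h1 (Set.union_subset hWb (hT'.curve_subset hM hn)) (Or.inl hwW) fun a b hab => by
      refine (hWd a b hab).union_left ?_
      rw [Set.disjoint_left]
      intro x hx hxe
      obtain ⟨k, hk, hxk⟩ := hT'.mem_curve hx
      exact Set.disjoint_left.1 (hab.disjoint_eseg hM hτ (hT'.stp k hk)) hxe hxk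
    exact this.mono Set.subset_union_right Set.subset_union_left
  have hzc : toR (Γ u i) ∈ curve (Γ u) := toR_mem_curve _ i
  refine ⟨u', j, K' ∪ (eseg (Γ u i) w ∪ (W ∪ curve (Γ u'))), hu', hsep u' hu' hdisj,
    ⟨C0 ∪ W, hC0.union _ hwC hwW hWc, Set.union_subset hC0s fun x hx => ⟨hWB hx, fun hx' =>
      Set.disjoint_left.1 hWK hx (Or.inr hx')⟩, Or.inl hw0C, Or.inr hzW⟩, ?_, ?_, ?_,
    Set.subset_union_left, fun x hx => Or.inr (Or.inr (Or.inr hx)), ?_⟩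
  · have := abs_sub_le ((Γ u' j).1 : ℝ) w.1 v.1
    linarith
  · exact hKp.union _ (hmem hzc) (Or.inl (left_mem_eseg _ _))
      ((isPreconnected_eseg _ _).union _ (right_mem_eseg _ _) (Or.inl hwW)
        (hWc.union _ hzW (toR_mem_curve _ j) (isPreconnected_curve _)))
  · exact Set.union_subset hKs (Set.union_subset
      ((convex_bigBox n).segment_subset (hKs (hmem hzc)) (hWb hwW))
      (Set.union_subset hWb (hT'.curve_subset hM hn)))
  · intro u'' hu'' hd''
    rw [neg_neg] at hu''
    obtain ⟨T'', hT''⟩ := S.absorbed hτ hu''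
    refine hd''.union_right (Disjoint.union_right ?_ (Disjoint.union_right ?_ ?_))
    · rw [Set.disjoint_left]
      intro x hx hxe
      obtain ⟨k, hk, hxk⟩ := hT''.mem_curve hx
      have := hw.eseg_inter hz (hT''.stp k hk).1 (hT''.stp k hk).diag hxe hxk
      subst this
      exact Set.disjoint_left.1 hd'' hx (hmem hzc)
    · exact (hedge hT'' hWd).symm
    · exact hT''.disjoint_curve hM hτ hT'

end Exploration

section Counting

variable {n : ℤ} {M : Set ((ℤ × ℤ) × (ℤ × ℤ))} {Γ : ℤ × ℤ → ℕ → ℤ × ℤ} {v : ℝ × ℝ}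
  {r1 r2 D d : ℝ} {π K K' : Set (ℝ × ℝ)} {w0 u u0 : ℤ × ℤ} {τ τ0 : ℤ} {i T0 : ℕ}

lemma Tip.entry (S : Setup M n Γ v r1 r2 D π w0) (t : Tip n Γ v r1 r2 π w0 d K K' τ u i) :
    (Set.range (interp (Γ u)) ∩
      betweenRegion (boxR v r1 r2) π (horEdges v r1 r2)).Nonempty := by
  obtain ⟨C, hC, hCs, hw, hz⟩ := t.conn
  refine ⟨toR (Γ u i), ⟨i, interp_nat _ _⟩, Or.inr ⟨(hCs hz).1, fun y hy hj => ?_⟩⟩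
  obtain ⟨γ, hγ⟩ := hj
  have h1 : IsPreconnected (Set.range γ) := isPreconnected_range γ.continuous
  have h2 := S.safe (C ∪ Set.range γ) (hC.union _ hz ⟨0, γ.source⟩ h1)
    (Set.union_subset hCs (Set.range_subset_iff.2 hγ)) (Or.inl hw)
  exact Set.disjoint_left.1 h2 (Or.inr ⟨1, γ.target⟩) hy

lemma Tip.step (S : Setup M n Γ v r1 r2 D π w0) (hτ : τ = 1 ∨ τ = -1) (hτ0 : τ0 = 1 ∨ τ0 = -1)
    (hA0 : Absorbed M n τ0 (Γ u0) T0) (hπ0 : π ⊆ curve (Γ u0))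
    (t : Tip n Γ v r1 r2 π w0 d K K' τ u i) (hπ : π ⊆ K) (hKp : IsPreconnected K)
    (hd : d + 2 + D ≤ r1 - 3) :
    ∃ u' j K'', Tip n Γ v r1 r2 π w0 (d + 2 + D) K' K'' (-τ) u' j := by
  have hM := S.matching
  have hn := S.four_dvd
  have hD := S.disp_nonneg
  obtain ⟨T, hT⟩ := S.absorbed hτ t.src
  obtain ⟨C, hC, hCs, hw0, hz⟩ := t.conn
  have hnear := t.near
  have hzn : |(Γ u i).1| ≤ n := by
    rw [abs_le] at hnear
    have h1 := S.width ((Γ u i).1 + 1) (by rw [abs_le]; constructor <;> linarith)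
    have h2 := S.width ((Γ u i).1 - 1) (by rw [abs_le]; constructor <;> linarith)
    rw [abs_le] at h1 h2 ⊢
    constructor <;> rify <;> linarith
  have hi : i < T := by
    by_contra! hcon
    rw [hT.const i hcon] at hzn
    exact hT.out hzn
  have hs := hT.stp i hi
  obtain ⟨w, hax, hw2, hw1, hside⟩ := hT.one_side hM hn hτ
    (by rw [(S.pth τ hτ u t.src).1]; exact t.src) hi hKp (t.le.trans t.sub) t.disj
  have hwt := hax.typ hτ hs.1
  have hwn : |w.2| ≤ n := by
    rcases hw2 with h | h <;> rw [h] <;> exact (hT.bounds hM hn _).2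
  have hwx : |w.1| ≤ n + 1 := by
    rcases hw1 with h | h <;> rw [h] <;> exact (hT.bounds hM hn _).1
  have hwb : toR w ∈ bigBox n := by
    constructor
    · simp only [toR]; exact_mod_cast hwx
    · simp only [toR]; exact_mod_cast hwn
  have hwd : |(w.1 : ℝ) - v.1| ≤ d + 2 := by
    have h1 : |(w.1 : ℝ) - (Γ u i).1| ≤ 2 := by
      have : |w.1 - (Γ u i).1| ≤ 2 := by
        unfold Axis at hax
        rw [abs_le]
        omega
      exact_mod_cast this
    have := abs_sub_le (w.1 : ℝ) (Γ u i).1 v.1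
    linarith
  have hwK : ∀ C, IsPreconnected C → C ⊆ bigBox n → toR w ∈ C →
      (∀ a b, Stp M n τ a b → Disjoint C (eseg a b)) → Disjoint C K := by
    intro C h1 h2 h3 h4
    refine hside C h1 h2 h3 ?_
    rw [Set.disjoint_left]
    intro x hx hxc
    obtain ⟨k, hk, hxk⟩ := hT.mem_curve hxc
    exact Set.disjoint_left.1 (h4 _ _ (hT.stp k hk)) hx hxk
  have hwπ : toR w ∉ π := fun hmem => by
    have h1 := hwK {toR w} isPreconnected_singleton (Set.singleton_subset_iff.2 hwb) rfl
      fun a b hab => Set.disjoint_singleton_left.2 (hab.toR_notMem_eseg hτ hwt)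
    exact Set.disjoint_left.1 h1 rfl (hπ hmem)
  have heπ : Disjoint (eseg (Γ u i) w) π := by
    rw [Set.disjoint_left]
    intro x hx hxπ
    obtain ⟨k, hk, hxk⟩ := hA0.mem_curve (hπ0 hxπ)
    have hs0 := hA0.stp k hk
    by_cases he : τ0 = τ
    · subst he
      have := hax.eseg_inter hs.1 hs0.1 hs0.diag hx hxk
      subst this
      exact (hCs hz).2 hxπ
    · have he : τ0 = -τ := by omega
      subst he
      have hax' : Axis w (Γ u i) := by
        unfold Axis at hax ⊢
        omega
      rw [eseg_comm] at hx
      have := hax'.eseg_inter hwt hs0.1 hs0.diag hx hxk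
      subst this
      exact hwπ hxπ
  have hwB : |(w.2 : ℝ) - v.2| ≤ r2 := by
    by_contra! hcon
    obtain ⟨y, hy, hyh, hys⟩ := exists_exit (y := toR w) (hCs hz).1
      (by simp only [toR]; linarith) hcon
    have hsub : segment ℝ (toR (Γ u i)) y ⊆ eseg (Γ u i) w :=
      (convex_segment _ _).segment_subset (left_mem_segment _ _ _) hy
    have := S.safe (C ∪ segment ℝ (toR (Γ u i)) y)
      (hC.union _ hz (left_mem_segment _ _ _) (convex_segment _ _).isPreconnected)
      (Set.union_subset hCs fun x hx => ⟨hys hx, Set.disjoint_left.1 heπ (hsub hx)⟩) (Or.inl hw0)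
    exact Set.disjoint_left.1 this (Or.inr (right_mem_segment _ _ _)) hyh
  have heB : eseg (Γ u i) w ⊆ boxR v r1 r2 :=
    (convex_boxR v r1 r2).segment_subset (hCs hz).1 ⟨by simp only [toR]; linarith, hwB⟩
  refine S.exists_tip hτ t.src t.pre t.sub t.mem t.sep hax hwn hwd hd
    (fun C h1 h2 h3 h4 => ?_) (C0 := C ∪ eseg (Γ u i) w)
    (hC.union _ hz (left_mem_eseg _ _) (isPreconnected_eseg _ _))
    (Set.union_subset hCs fun x hx => ⟨heB hx, Set.disjoint_left.1 heπ hx⟩) (Or.inl hw0)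
    (Or.inr (right_mem_eseg _ _))
  rw [Set.union_eq_self_of_subset_right hπ]
  exact hwK C h1 h2 h3 h4

/-- In a wide box there are many backbone paths entering the region between the crossings. -/
lemma Setup.exists_sources (S : Setup M n Γ v r1 r2 D π w0) (hτ0 : τ0 = 1 ∨ τ0 = -1)
    (hu0 : Src n τ0 u0) (hπ0 : π ⊆ curve (Γ u0))
    (hQ : (Set.range (interp (Γ u0)) ∩
      betweenRegion (boxR v r1 r2) π (horEdges v r1 r2)).Nonempty) {m : ℕ}
    (hax : Axis (Γ u0 m) w0) (hwn : |w0.2| ≤ n) (hwd : |(w0.1 : ℝ) - v.1| ≤ d)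
    (hwB : toR w0 ∈ boxR v r1 r2 \ π) (k : ℕ) (hd : d + D + k * (2 + D) ≤ r1 - 3) :
    ∃ U : Finset (ℤ × ℤ), U.card = k + 2 ∧ ∀ u ∈ U, (∃ τ : ℤ, (τ = 1 ∨ τ = -1) ∧ Src n τ u) ∧
      (Set.range (interp (Γ u)) ∩
        betweenRegion (boxR v r1 r2) π (horEdges v r1 r2)).Nonempty := by
  have hM := S.matching
  have hn := S.four_dvd
  have hD := S.disp_nonneg
  obtain ⟨T0, hA0⟩ := S.absorbed hτ0 hu0
  have key : ∀ k : ℕ, d + D + k * (2 + D) ≤ r1 - 3 →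
      ∃ (U : Finset (ℤ × ℤ)) (K K' : Set (ℝ × ℝ)) (τ : ℤ) (u : ℤ × ℤ) (i : ℕ),
        (τ = 1 ∨ τ = -1) ∧ U.card = k + 1 ∧
        (∀ u ∈ U, ((∃ τ : ℤ, (τ = 1 ∨ τ = -1) ∧ Src n τ u) ∧ (Set.range (interp (Γ u)) ∩
          betweenRegion (boxR v r1 r2) π (horEdges v r1 r2)).Nonempty) ∧ curve (Γ u) ⊆ K) ∧
        π ⊆ K ∧ IsPreconnected K ∧
        Tip n Γ v r1 r2 π w0 (d + D + k * (2 + D)) K K' τ u i := by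
    intro k
    induction k with
    | zero =>
      intro hd
      push_cast at hd
      obtain ⟨u', j, K'', t⟩ := S.exists_tip (K := ∅) hτ0 hu0 (isPreconnected_curve _)
        (hA0.curve_subset hM hn) subset_rfl (fun u' hu' _ => by
          obtain ⟨T', hT'⟩ := S.absorbed (by omega) hu'
          exact (hA0.disjoint_curve hM hτ0 hT').symm) hax hwn hwd (by linarith)
        (fun C _ _ _ h4 => by
          rw [Set.empty_union]
          refine Disjoint.mono_right hπ0 (Set.disjoint_left.2 fun x hx hxc => ?_)
          obtain ⟨k, hk, hxk⟩ := hA0.mem_curve hxc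
          exact Set.disjoint_left.1 (h4 _ _ (hA0.stp k hk)) hx hxk)
        (isPreconnected_singleton (x := toR w0)) (Set.singleton_subset_iff.2 hwB) rfl rfl
      refine ⟨{u0}, curve (Γ u0), K'', -τ0, u', j, by omega, by simp, ?_, hπ0,
        isPreconnected_curve _, by simpa using t⟩
      intro u hu
      rw [Finset.mem_singleton] at hu
      subst hu
      exact ⟨⟨⟨τ0, hτ0, hu0⟩, hQ⟩, subset_rfl⟩
    | succ k ih =>
      intro hd
      push_cast at hd
      obtain ⟨U, K, K', τ, u, i, hτ, hcard, hU, hπ, hK, t⟩ := ih (by linarith)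
      obtain ⟨u', j, K'', t'⟩ := t.step S hτ hτ0 hA0 hπ0 hπ hK (by linarith)
      have huU : u ∉ U := fun h => by
        obtain ⟨x, hx⟩ := curve_nonempty (Γ u)
        exact Set.disjoint_left.1 t.disj hx ((hU u h).2 hx)
      refine ⟨insert u U, K', K'', -τ, u', j, by omega,
        by rw [Finset.card_insert_of_notMem huU, hcard], ?_, hπ.trans t.le, t.pre, ?_⟩
      · intro u'' hu''
        rw [Finset.mem_insert] at hu''
        rcases hu'' with rfl | hu''
        · exact ⟨⟨⟨τ, hτ, t.src⟩, t.entry S⟩, t.mem⟩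
        · exact ⟨(hU _ hu'').1, (hU _ hu'').2.trans t.le⟩
      · convert t' using 1
        push_cast
        ring
  obtain ⟨U, K, K', τ, u, i, hτ, hcard, hU, hπ, hK, t⟩ := key k hd
  have huU : u ∉ U := fun h => by
    obtain ⟨x, hx⟩ := curve_nonempty (Γ u)
    exact Set.disjoint_left.1 t.disj hx ((hU u h).2 hx)
  refine ⟨insert u U, by rw [Finset.card_insert_of_notMem huU, hcard], fun u' hu' => ?_⟩
  rw [Finset.mem_insert] at hu'
  rcases hu' with rfl | hu'
  · exact ⟨⟨τ, hτ, t.src⟩, t.entry S⟩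
  · exact (hU u' hu').1

end Counting

/-- The parabolic bound on the horizontal displacement at height at most `2 * r2`. -/
lemma parabola_bound {n m r2 : ℝ} (hn : 4 ≤ n) (hr2 : 1 ≤ r2) (hm : 0 ≤ m) (hm1 : m ≤ 2 * r2)
    (hm2 : m ≤ 2 * n) :
    (Real.log n ^ 2 + Real.log (m + 1)) * Real.sqrt (m + 1) ≤
      4.5 * (Real.sqrt r2 * Real.log n ^ 2) := by
  have h4 : Real.log 4 = 2 * Real.log 2 := by
    rw [show (4 : ℝ) = 2 ^ 2 by norm_num, Real.log_pow]; norm_num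
  have hl2 := Real.log_two_gt_d9
  have hln : Real.log 4 ≤ Real.log n := Real.log_le_log (by norm_num) hn
  have hlm : Real.log (m + 1) ≤ Real.log 4 + Real.log n := by
    rw [← Real.log_mul (by norm_num) (by linarith)]
    exact Real.log_le_log (by linarith) (by linarith)
  have hs : Real.sqrt (m + 1) ≤ 1.75 * Real.sqrt r2 := by
    rw [Real.sqrt_le_left (by positivity), mul_pow, Real.sq_sqrt (by linarith)]
    linarith
  have h1 : Real.log n ^ 2 + Real.log (m + 1) ≤ 2.45 * Real.log n ^ 2 := by nlinarith
  calc _ ≤ (2.45 * Real.log n ^ 2) * (1.75 * Real.sqrt r2) :=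
        mul_le_mul h1 hs (Real.sqrt_nonneg _) (by positivity)
    _ ≤ _ := by nlinarith [mul_nonneg (Real.sqrt_nonneg r2) (sq_nonneg (Real.log n))]

lemma le_sqrt_mul_log_sq {n r2 : ℝ} (hn : 4 ≤ n) (hr2 : 1 ≤ r2) :
    1.9 ≤ Real.sqrt r2 * Real.log n ^ 2 := by
  have h4 : Real.log 4 = 2 * Real.log 2 := by
    rw [show (4 : ℝ) = 2 ^ 2 by norm_num, Real.log_pow]; norm_num
  have hl2 := Real.log_two_gt_d9
  have hln : Real.log 4 ≤ Real.log n := Real.log_le_log (by norm_num) hn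
  have hs : 1 ≤ Real.sqrt r2 := Real.one_le_sqrt.2 hr2
  nlinarith [sq_nonneg (Real.log n)]

section Forests

variable {n : ℤ} {M : Set ((ℤ × ℤ) × (ℤ × ℤ))}

lemma typ_neg_one {v : ℤ × ℤ} : Typ (-1) v ↔ Ntilde v := by
  simp [Typ, Ntilde]

lemma nStepRel_eq : NStepRel M n = Stp M n (-1) := by
  funext v w
  simp [NStepRel, Stp, typ_neg_one]

lemma src_neg_one {v : ℤ × ℤ} : Src n (-1) v ↔ NSource n v := by
  simp [Src, NSource, typ_neg_one]

lemma nBackbone_eq : NBackbone M n = BB M n (-1) := by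
  simp [NBackbone, BB, src_neg_one, nStepRel_eq]

lemma displacement_bound {a b a' b' n : ℤ} {r2 : ℝ} (hn : 4 ≤ n) (hr2 : 1 ≤ r2)
    (hb : |b| ≤ n) (hb' : |b'| ≤ n) (hd : |(b' : ℝ) - b| ≤ 2 * r2)
    (h : (a' - a, b' - b) ∈ PparS (Real.log n ^ 2) ∨
      (-(a' - a), -(b' - b)) ∈ PparS (Real.log n ^ 2)) :
    |(a' : ℝ) - a| ≤ 4.5 * (Real.sqrt r2 * Real.log n ^ 2) := by
  have hb1 : |(b : ℝ)| ≤ n := by exact_mod_cast hb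
  have hb2 : |(b' : ℝ)| ≤ n := by exact_mod_cast hb'
  have hn' : (4 : ℝ) ≤ n := by exact_mod_cast hn
  rw [abs_le] at hb1 hb2 hd
  rcases h with ⟨-, h⟩ | ⟨-, h⟩
  · push_cast at h
    exact h.trans (parabola_bound hn' hr2 (le_max_right _ _)
      (max_le (by linarith) (by linarith)) (max_le (by linarith) (by linarith)))
  · push_cast at h
    rw [abs_neg] at h
    exact h.trans (parabola_bound hn' hr2 (le_max_right _ _)
      (max_le (by linarith) (by linarith)) (max_le (by linarith) (by linarith)))

lemma ParaSHolds.narrow {r2 : ℝ} (h : ParaSHolds M n (Real.log n ^ 2)) (hn : 4 ≤ n)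
    (hr2 : 1 ≤ r2) : Narrow M n 1 r2 (4.5 * (Real.sqrt r2 * Real.log n ^ 2)) :=
  fun w z hw hwn hwz hz hd => displacement_bound hn hr2 hwn.2 hz hd (Or.inl (h w z hw hwn hwz))

lemma ParaNHolds.narrow {r2 : ℝ} (h : ParaNHolds M n (Real.log n ^ 2)) (hn : 4 ≤ n)
    (hr2 : 1 ≤ r2) : Narrow M n (-1) r2 (4.5 * (Real.sqrt r2 * Real.log n ^ 2)) := by
  intro w z hw hwn hwz hz hd
  rw [← nStepRel_eq, ← nBackbone_eq] at hwz
  exact displacement_bound hn hr2 hwn.2 hz hd (Or.inr (h w z (typ_neg_one.1 hw) hwn hwz))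

lemma finite_sources (n : ℤ) (P : ℤ × ℤ → Prop)
    (h : ∀ u, P u → |u.1| ≤ n ∧ |u.2| = n) : {u | P u}.Finite :=
  (Set.finite_Icc ((-n, -n) : ℤ × ℤ) (n, n)).subset fun u hu => by
    obtain ⟨h1, h2⟩ := h u hu
    have := abs_le.1 h1
    have := abs_le.1 h2.le
    exact ⟨⟨by omega, by omega⟩, ⟨by omega, by omega⟩⟩

end Forests

section Onion

variable {n : ℤ} {M : Set ((ℤ × ℤ) × (ℤ × ℤ))} {Γ : ℤ × ℤ → ℕ → ℤ × ℤ} {v : ℝ × ℝ}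
  {r1 r2 D σ : ℝ} {τ0 : ℤ} {u0 : ℤ × ℤ}

/-- Two opposite crossings of a box by a backbone path force many backbone paths to enter the
region between them. -/
lemma exists_sources_of_crossings (hM : IsAztecMatching n M) (hn : (4 : ℤ) ∣ n) (h0 : 0 ≤ n)
    (hΓ : ∀ τ : ℤ, τ = 1 ∨ τ = -1 → ∀ u, Src n τ u → IsPth M n τ u (Γ u)) (hD : 0 ≤ D)
    (hnarrow : ∀ τ : ℤ, τ = 1 ∨ τ = -1 → Narrow M n τ r2 D)
    (hτ0 : τ0 = 1 ∨ τ0 = -1) (hu0 : Src n τ0 u0) (hr1 : 3 < r1) (hσ : σ = 1 ∨ σ = -1)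
    {s1 t1 s2 t2 : ℝ} (hs1 : 0 ≤ s1) (h12 : s1 ≤ t1) (h23 : t1 ≤ s2) (h34 : s2 ≤ t2)
    (hseg1 : interp (Γ u0) '' Set.Icc s1 t1 ⊆ boxR v r1 r2)
    (hseg2 : interp (Γ u0) '' Set.Icc s2 t2 ⊆ boxR v r1 r2)
    (he1 : (interp (Γ u0) s1).1 = v.1 + σ * r1) (he2 : (interp (Γ u0) t1).1 = v.1 - σ * r1)
    (he3 : (interp (Γ u0) s2).1 = v.1 - σ * r1) (he4 : (interp (Γ u0) t2).1 = v.1 + σ * r1)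
    (k : ℕ) (hk : 3 + D + k * (2 + D) ≤ r1 - 3) :
    ∃ U : Finset (ℤ × ℤ), U.card = k + 2 ∧ ∀ u ∈ U, (∃ τ : ℤ, (τ = 1 ∨ τ = -1) ∧ Src n τ u) ∧
      (Set.range (interp (Γ u)) ∩
        betweenRegion (boxR v r1 r2)
          (interp (Γ u0) '' Set.Icc s1 t1 ∪ interp (Γ u0) '' Set.Icc s2 t2)
          (horEdges v r1 r2)).Nonempty := by
  obtain ⟨T, hA⟩ := (hΓ τ0 hτ0 u0 hu0).exists_absorbed hM hn h0 hτ0 hu0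
  have hσr : σ * r1 ≠ 0 := by rcases hσ with rfl | rfl <;> simp <;> linarith
  have hs2T : s2 < T := by
    by_contra hc
    push Not at hc
    rw [hA.interp_const hc] at he3
    rw [hA.interp_const (hc.trans h34), he3] at he4
    exact hσr (by linarith)
  set p := Γ u0 with hp
  have hX1 : ∀ t' ∈ Set.Icc s1 t1, |(interp p t').1 - v.1| ≤ r1 :=
    fun t' ht => (hseg1 ⟨t', ht, rfl⟩).1
  have hX2 : ∀ t' ∈ Set.Icc s2 t2, |(interp p t').1 - v.1| ≤ r1 :=
    fun t' ht => (hseg2 ⟨t', ht, rfl⟩).1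
  have hr0 : 0 < r1 := by linarith
  have hσ' : -σ = 1 ∨ -σ = -1 := by rcases hσ with rfl | rfl <;> simp
  obtain ⟨i0, i1, -, -, -, hi1t, hi1T, hc1⟩ := hA.exists_cross hr0 hσ hs1 h12
    (h23.trans hs2T.le) hX1 he1 he2
  have he4' : (interp p (min t2 T)).1 = v.1 - -σ * r1 := by
    rcases le_total t2 (T : ℝ) with h | h
    · rw [min_eq_left h, he4]; ring
    · rw [min_eq_right h, hA.interp_const le_rfl, ← hA.interp_const h, he4]; ring
  obtain ⟨j0, j1, -, hj0s, -, -, hj1T, hc2'⟩ := hA.exists_cross hr0 hσ'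
    (hs1.trans (h12.trans h23)) (le_min h34 hs2T.le) (min_le_right _ _)
    (fun t' ht => hX2 t' ⟨ht.1, ht.2.trans (min_le_left _ _)⟩) (by rw [he3]; ring) he4'
  have hc2 : Cross p v.1 r1 (-σ) j0 j1 (interp p '' Set.Icc s2 t2) :=
    ⟨hc2'.lt, hc2'.start, hc2'.finish, fun i h1 h2 x hx hxr =>
      Set.image_mono (Set.Icc_subset_Icc_right (min_le_left _ _)) (hc2'.inside i h1 h2 x hx hxr)⟩
  have hij : i1 ≤ j0 + 1 := by
    have : (i1 : ℝ) < (j0 + 2 : ℕ) := by push_cast; linarith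
    have : i1 < j0 + 2 := by exact_mod_cast this
    omega
  obtain ⟨m, w0, hw0, hne, hmT, hm, hx1, hx2, hw1, hw2⟩ :=
    hc1.exists_dual hM hn hτ0 hA hσ hσ' hr1 hc2 hi1T hj1T hij
  set π := interp p '' Set.Icc s1 t1 ∪ interp p '' Set.Icc s2 t2 with hπdef
  have hπB : π ⊆ boxR v r1 r2 := Set.union_subset hseg1 hseg2
  have hπc : π ⊆ curve p := by
    rintro x (⟨t, ht, rfl⟩ | ⟨t, ht, rfl⟩)
    · exact interp_mem_curve (hs1.trans ht.1)
    · exact interp_mem_curve (hs1.trans (h12.trans (h23.trans ht.1)))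
  have hin : ∀ x ∈ eseg (p m) (p (m + 1)), |x.1 - v.1| ≤ r1 → x ∈ π := by
    rcases hm with hm | hm
    · exact fun x hx hxr => Or.inl (hc1.inside m hm.1 hm.2 x hx hxr)
    · exact fun x hx hxr => Or.inr (hc2.inside m hm.1 hm.2 x hx hxr)
  have hB1 := hπB (hin _ (left_mem_eseg _ _) (show |((p m).1 : ℝ) - v.1| ≤ r1 by linarith))
  have hB2 := hπB (hin _ (right_mem_eseg _ _) (show |((p (m + 1)).1 : ℝ) - v.1| ≤ r1 by linarith))
  have hwd : |(w0.1 : ℝ) - v.1| ≤ 3 := by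
    rcases hw1 with h | h <;> rwa [h]
  have hwB : toR w0 ∈ boxR v r1 r2 \ π := by
    refine ⟨⟨hwd.trans hr1.le, ?_⟩, fun h => hA.toR_notMem_curve hτ0 hw0 (hπc h)⟩
    rcases hw2 with h | h
    · simpa [toR, h] using hB1.2
    · simpa [toR, h] using hB2.2
  have hwn : |w0.2| ≤ n := by
    rcases hw2 with h | h <;> rw [h]
    exacts [(hA.bounds hM hn m).2, (hA.bounds hM hn (m + 1)).2]
  have hax : Axis (p m) w0 := by
    have hst := hA.stp m hmT
    have hd := hst.diag
    have ht1 := hst.1.disjoint hτ0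
    have ht2 := hst.typ_right.disjoint hτ0
    have e1 : w0 ≠ p m := fun h => ht1 (h ▸ hw0)
    have e2 : w0 ≠ p (m + 1) := fun h => ht2 (h ▸ hw0)
    rw [Ne, Prod.ext_iff] at e1 e2
    unfold Diag at hd
    unfold Axis
    omega
  have hwidth : ∀ x : ℝ, |x - v.1| ≤ r1 → |x| ≤ n + 1 := by
    intro x hx
    have b1 := (hA.curve_subset hM hn (interp_mem_curve hs1)).1
    have b2 := (hA.curve_subset hM hn (interp_mem_curve (hs1.trans h12))).1
    rw [he1] at b1
    rw [he2] at b2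
    rw [abs_le] at *
    rcases hσ with rfl | rfl <;> constructor <;> linarith
  have S : Setup M n Γ v r1 r2 D π w0 := by
    refine ⟨hM, hn, h0, hΓ, hD, hnarrow, hwidth, fun C hC hCB hwC => ?_⟩
    exact hc1.no_escape hτ0 hσ hσ' (hA.lpath hi1T) (hA.lpath hj1T)
      (fun i => (hA.bounds hM hn i).2) hc2 hπB hw0 (hwd.trans_lt hr1) hne hC hCB hwC
  exact S.exists_sources hτ0 hu0 hπc
    ⟨interp p s1, ⟨s1, rfl⟩, Or.inl (Or.inl ⟨s1, ⟨le_rfl, h12⟩, rfl⟩)⟩ hax hwn hwd hwB k hk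

end Onion

theorem stmt14 (n : ℕ) (hn : 3 ≤ n) (hn4 : 4 ∣ n)
    (M : Set ((ℤ × ℤ) × (ℤ × ℤ))) (hM : IsAztecMatching (n : ℤ) M)
    (hParaS : ParaSHolds M (n : ℤ) ((Real.log n) ^ 2))
    (hParaN : ParaNHolds M (n : ℤ) ((Real.log n) ^ 2))
    -- the family of backbone paths, indexed by their sources
    (Γ : (ℤ × ℤ) → ℕ → ℤ × ℤ)
    (hΓS : ∀ u, SSource (n : ℤ) u → IsSPath M (n : ℤ) u (Γ u))
    (hΓN : ∀ u, NSource (n : ℤ) u → IsNPath M (n : ℤ) u (Γ u))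
    (r1 r2 : ℝ) (hr2 : 1 ≤ r2) (l : ℕ) (hl : 1 ≤ l)
    (v : ℝ × ℝ)
    -- the onion: a backbone path with two disjoint opposite crossings of the box
    (u0 : ℤ × ℤ) (hu0 : SSource (n : ℤ) u0 ∨ NSource (n : ℤ) u0)
    (s1 t1 s2 t2 : ℝ) (hs1 : 0 ≤ s1) (h12 : s1 ≤ t1) (h23 : t1 ≤ s2) (h34 : s2 ≤ t2)
    (hseg1 : interp (Γ u0) '' Set.Icc s1 t1 ⊆ boxR v r1 r2)
    (hseg2 : interp (Γ u0) '' Set.Icc s2 t2 ⊆ boxR v r1 r2)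
    (hpattern :
      (interp (Γ u0) s1 ∈ vertEdge v r1 r2 1 ∧ interp (Γ u0) t1 ∈ vertEdge v r1 r2 (-1) ∧
       interp (Γ u0) s2 ∈ vertEdge v r1 r2 (-1) ∧ interp (Γ u0) t2 ∈ vertEdge v r1 r2 1) ∨
      (interp (Γ u0) s1 ∈ vertEdge v r1 r2 (-1) ∧ interp (Γ u0) t1 ∈ vertEdge v r1 r2 1 ∧
       interp (Γ u0) s2 ∈ vertEdge v r1 r2 1 ∧ interp (Γ u0) t2 ∈ vertEdge v r1 r2 (-1)))
    -- at most `l` backbone paths enter the region bounded between the two segments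
    (hcount : {u : ℤ × ℤ | (SSource (n : ℤ) u ∨ NSource (n : ℤ) u) ∧
        (Set.range (interp (Γ u)) ∩
          betweenRegion (boxR v r1 r2)
            (interp (Γ u0) '' Set.Icc s1 t1 ∪ interp (Γ u0) '' Set.Icc s2 t2)
            (horEdges v r1 r2)).Nonempty}.ncard ≤ l) :
    r1 < 10 * l * Real.sqrt r2 * (Real.log n) ^ 2 := by
  by_contra! hcon
  have hn4' : (4 : ℤ) ∣ n := by exact_mod_cast hn4
  have hn4le : 4 ≤ n := Nat.le_of_dvd (by omega) hn4
  have hA := le_sqrt_mul_log_sq (n := n) (r2 := r2) (by exact_mod_cast hn4le) hr2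
  set A := Real.sqrt r2 * Real.log n ^ 2 with hAdef
  obtain ⟨k, rfl⟩ : ∃ k, l = k + 1 := ⟨l - 1, by omega⟩
  have hr1 : 10 * ((k : ℝ) + 1) * A ≤ r1 := by
    rw [hAdef, ← mul_assoc]
    exact_mod_cast hcon
  have hkA : 0 ≤ (k : ℝ) * (A - 1.9) := mul_nonneg k.cast_nonneg (by linarith)
  have hk0 : (0 : ℝ) ≤ k := k.cast_nonneg
  have hΓ : ∀ τ : ℤ, τ = 1 ∨ τ = -1 → ∀ u, Src n τ u → IsPth M n τ u (Γ u) := by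
    rintro τ (rfl | rfl) u hu
    · exact hΓS u hu
    · have h := hΓN u (src_neg_one.1 hu)
      rwa [IsNPath, nStepRel_eq] at h
  have hnarrow : ∀ τ : ℤ, τ = 1 ∨ τ = -1 → Narrow M n τ r2 (4.5 * A) := by
    rintro τ (rfl | rfl)
    · exact ParaSHolds.narrow (by exact_mod_cast hParaS) (by exact_mod_cast hn4le) hr2
    · exact ParaNHolds.narrow (by exact_mod_cast hParaN) (by exact_mod_cast hn4le) hr2
  obtain ⟨τ0, hτ0, hu0'⟩ : ∃ τ0 : ℤ, (τ0 = 1 ∨ τ0 = -1) ∧ Src n τ0 u0 :=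
    hu0.elim (fun h => ⟨1, Or.inl rfl, h⟩) (fun h => ⟨-1, Or.inr rfl, src_neg_one.2 h⟩)
  obtain ⟨σ, hσ, he1, he2, he3, he4⟩ : ∃ σ : ℝ, (σ = 1 ∨ σ = -1) ∧
      (interp (Γ u0) s1).1 = v.1 + σ * r1 ∧ (interp (Γ u0) t1).1 = v.1 - σ * r1 ∧
      (interp (Γ u0) s2).1 = v.1 - σ * r1 ∧ (interp (Γ u0) t2).1 = v.1 + σ * r1 := by
    rcases hpattern with ⟨h1, h2, h3, h4⟩ | ⟨h1, h2, h3, h4⟩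
    · exact ⟨1, Or.inl rfl, h1.2, by linarith [h2.2], by linarith [h3.2], h4.2⟩
    · exact ⟨-1, Or.inr rfl, h1.2, by linarith [h2.2], by linarith [h3.2], h4.2⟩
  obtain ⟨U, hUc, hU⟩ := exists_sources_of_crossings hM hn4' (by omega) hΓ
    (D := 4.5 * A) (by linarith) hnarrow hτ0 hu0' (by nlinarith) hσ hs1 h12 h23 h34 hseg1 hseg2
    he1 he2 he3 he4 k (by nlinarith)
  have hfin := finite_sources (n : ℤ) (fun u => (SSource (n : ℤ) u ∨ NSource (n : ℤ) u) ∧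
    (Set.range (interp (Γ u)) ∩ betweenRegion (boxR v r1 r2)
      (interp (Γ u0) '' Set.Icc s1 t1 ∪ interp (Γ u0) '' Set.Icc s2 t2)
      (horEdges v r1 r2)).Nonempty) fun u hu => hu.1.elim (fun h => h.2) (fun h => h.2)
  have hle := Set.ncard_le_ncard (s := (U : Set (ℤ × ℤ))) (fun u hu => by
    obtain ⟨⟨τ, rfl | rfl, hs⟩, hne⟩ := hU u hu
    · exact ⟨Or.inl hs, hne⟩
    · exact ⟨Or.inr (src_neg_one.1 hs), hne⟩) hfin
  rw [Set.ncard_coe_finset, hUc] at hle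
  omega

end
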